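/- arXiv:2507.20260 — 4 statements merged into one kernel-verified Lean document; each statement's English description precedes it below -/
import Mathlib

section
/- For n > 9, write n = 3m + a with a ∈ {0,1,2}. Then R_3(n) = 6m² - 15m + 7 if a = 0, R_3(n) = 6m² - 11m + 2 if a = 1, and R_3(n) = 6m² - 7m - 1 if a = 2. -/
/-- The `i`-th largest part (1-indexed) of a partition, or `0` if out of range. -/
def part {n : ℕ} (p : n.Partition) (i : ℕ) : ℕ :=
  (p.parts.sort (· ≥ ·)).getD (i - 1) 0

open Classical in
/-- The size of the Durfee triangle of a partition: the largest `k` such that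
`λ_i ≥ k + 1 - i` for all `1 ≤ i ≤ k`. -/
noncomputable def durfee {n : ℕ} (p : n.Partition) : ℕ :=
  Nat.findGreatest (fun k => ∀ i ∈ Finset.Icc 1 k, k + 1 ≤ part p i + i) n

open Classical in
/-- `R k n` : the number of partitions of `n` with Durfee triangle size exactly `k`. -/
noncomputable def R (k n : ℕ) : ℕ :=
  (Finset.univ.filter fun p : n.Partition => durfee p = k).card

/-- The partition function. -/
def P (n : ℕ) : ℕ := Fintype.card n.Partition

/-- The maximal Durfee triangle size among partitions of `n`. -/
noncomputable def F (n : ℕ) : ℕ := Finset.univ.sup fun p : n.Partition => durfee p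

namespace DT

/-- Conditions on the sorted list of parts. -/
def Good (n : ℕ) (l : List ℕ) : Prop :=
  l.Pairwise (· ≥ ·) ∧ (∀ x ∈ l, 0 < x) ∧ l.sum = n ∧
  (3 ≤ l.getD 0 0 ∧ 2 ≤ l.getD 1 0 ∧ 1 ≤ l.getD 2 0) ∧
  ¬ (4 ≤ l.getD 0 0 ∧ 3 ≤ l.getD 1 0 ∧ 2 ≤ l.getD 2 0 ∧ 1 ≤ l.getD 3 0)

theorem durfee_eq_three {n : ℕ} (hn : 9 < n) (p : n.Partition) :
    durfee p = 3 ↔ Good n (p.parts.sort (· ≥ ·)) := by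
  have h1 : (p.parts.sort (· ≥ ·)).Pairwise (· ≥ ·) := Multiset.pairwise_sort _ _
  have h2 : ∀ x ∈ p.parts.sort (· ≥ ·), 0 < x := fun x hx =>
    p.parts_pos ((Multiset.mem_sort _).1 hx)
  have h3 : (p.parts.sort (· ≥ ·)).sum = n := by
    rw [← Multiset.sum_coe, Multiset.sort_eq, p.parts_sum]
  unfold durfee
  refine Iff.trans (@Nat.findGreatest_eq_iff _ _ _ (fun _ => Classical.propDecidable _)) ?_
  simp only [Good, h1, h3, true_and]
  constructor
  · rintro ⟨-, hQ, hN⟩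
    have hQ := hQ (by norm_num)
    refine ⟨h2, ⟨?_, ?_, ?_⟩, ?_⟩
    · have := hQ 1 (by simp); simp [part] at this ⊢; omega
    · have := hQ 2 (by simp); simp [part] at this ⊢; omega
    · have := hQ 3 (by simp); simp [part] at this ⊢; omega
    · rintro ⟨a, b, c, d⟩
      refine hN (n := 4) (by norm_num) (by omega) ?_
      intro i hi
      rw [Finset.mem_Icc] at hi
      obtain ⟨hi1, hi2⟩ := hi
      interval_cases i <;> simp only [part] <;> norm_num <;> simp at a b c d <;> omega
  · rintro ⟨-, ⟨a, b, c⟩, hN⟩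
    refine ⟨by omega, ?_, ?_⟩
    · intro _ i hi
      rw [Finset.mem_Icc] at hi
      obtain ⟨hi1, hi2⟩ := hi
      interval_cases i <;> simp only [part] <;> norm_num <;> simp at a b c <;> omega
    · intro k hk hkn hQ
      apply hN
      have q1 := hQ 1 (by simp; omega)
      have q2 := hQ 2 (by simp; omega)
      have q3 := hQ 3 (by simp; omega)
      have q4 := hQ 4 (by simp; omega)
      simp only [part] at q1 q2 q3 q4
      norm_num at q1 q2 q3 q4 ⊢
      omega

theorem R_three_card {n : ℕ} (hn : 9 < n) (G : Finset (List ℕ))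
    (hG : ∀ l, l ∈ G ↔ Good n l) : R 3 n = G.card := by
  classical
  unfold R
  refine Finset.card_bij (fun p _ => p.parts.sort (· ≥ ·)) ?_ ?_ ?_
  · intro p hp
    rw [hG, ← durfee_eq_three hn]
    exact (Finset.mem_filter.1 hp).2
  · intro p _ q _ h
    apply Nat.Partition.ext
    have := congrArg (fun l : List ℕ => (l : Multiset ℕ)) h
    simpa [Multiset.sort_eq] using this
  · intro l hl
    have hl' := (hG l).1 hl
    let p : n.Partition := ⟨(l : Multiset ℕ), fun {i} hi => hl'.2.1 i (by simpa using hi),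
      by simpa using hl'.2.2.1⟩
    have hp : p.parts.sort (· ≥ ·) = l := by
      have : (p.parts.sort (· ≥ ·)).Perm l := by
        rw [← Multiset.coe_eq_coe, Multiset.sort_eq]
      exact this.eq_of_pairwise' (Multiset.pairwise_sort _ _) hl'.1
    refine ⟨p, ?_, hp⟩
    simp only [Finset.mem_filter, Finset.mem_univ, true_and]
    rw [durfee_eq_three hn, hp]
    exact hl'

theorem all_one (l : List ℕ) (h0 : ∀ x ∈ l, 0 < x) (h1 : ∀ x ∈ l, x ≤ 1) :
    ∃ j, l = List.replicate j 1 :=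
  ⟨l.length, List.eq_replicate_iff.2 ⟨rfl, fun x hx => le_antisymm (h1 x hx) (h0 x hx)⟩⟩

theorem all_two (l : List ℕ) (hs : l.Pairwise (· ≥ ·)) (h0 : ∀ x ∈ l, 0 < x)
    (h1 : ∀ x ∈ l, x ≤ 2) :
    ∃ i j, l = List.replicate i 2 ++ List.replicate j 1 := by
  induction l with
  | nil => exact ⟨0, 0, rfl⟩
  | cons x l ih =>
    rw [List.pairwise_cons] at hs
    have hx0 := h0 x (by simp)
    have hx1 := h1 x (by simp)
    by_cases hx : x = 2
    · obtain ⟨i, j, h⟩ := ih hs.2 (fun y hy => h0 y (by simp [hy])) (fun y hy => h1 y (by simp [hy]))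
      exact ⟨i + 1, j, by rw [h, hx, List.replicate_succ]; rfl⟩
    · obtain ⟨j, h⟩ := all_one (x :: l) h0 (by
        intro y hy
        rcases List.mem_cons.1 hy with h | h
        · omega
        · have := hs.1 y h; omega)
      exact ⟨0, j, by simpa using h⟩

theorem all_three (l : List ℕ) (hs : l.Pairwise (· ≥ ·)) (h0 : ∀ x ∈ l, 0 < x)
    (h1 : ∀ x ∈ l, x ≤ 3) :
    ∃ i j k, l = List.replicate i 3 ++ (List.replicate j 2 ++ List.replicate k 1) := by
  induction l with
  | nil => exact ⟨0, 0, 0, rfl⟩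
  | cons x l ih =>
    have hs' := hs
    rw [List.pairwise_cons] at hs
    have hx0 := h0 x (by simp)
    have hx1 := h1 x (by simp)
    by_cases hx : x = 3
    · obtain ⟨i, j, k, h⟩ := ih hs.2 (fun y hy => h0 y (by simp [hy])) (fun y hy => h1 y (by simp [hy]))
      exact ⟨i + 1, j, k, by rw [h, hx, List.replicate_succ]; rfl⟩
    · obtain ⟨j, k, h⟩ := all_two (x :: l) hs' h0 (by
        intro y hy
        rcases List.mem_cons.1 hy with h | h
        · omega
        · have := hs.1 y h; omega)
      exact ⟨0, j, k, by simpa using h⟩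

/-- The four shapes. -/
inductive Shape (n : ℕ) : List ℕ → Prop
  | A (a b c : ℕ) (h1 : 1 ≤ c) (h2 : c ≤ b) (h3 : b ≤ a) (h4 : 2 ≤ b) (hs : a + b + c = n) :
      Shape n [a, b, c]
  | B (a b j : ℕ) (h1 : 2 ≤ j) (h2 : 2 ≤ b) (h3 : b ≤ a) (h4 : 3 ≤ a) (hs : a + b + j = n) :
      Shape n (a :: b :: List.replicate j 1)
  | C (a i j : ℕ) (h1 : 2 ≤ i) (h2 : 3 ≤ i + j) (h3 : 3 ≤ a) (hs : a + 2 * i + j = n) :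
      Shape n (a :: (List.replicate i 2 ++ List.replicate j 1))
  | D (i j k : ℕ) (h1 : 2 ≤ i) (h2 : 3 ≤ i + j) (hs : 3 * i + 2 * j + k = n) :
      Shape n (List.replicate i 3 ++ (List.replicate j 2 ++ List.replicate k 1))

theorem good_of_shape {n : ℕ} (hn : 9 < n) {l : List ℕ} (h : Shape n l) : Good n l := by
  cases h with
  | A a b c h1 h2 h3 h4 hs =>
    refine ⟨?_, ?_, ?_, ?_, ?_⟩ <;> simp <;> omega
  | B a b j h1 h2 h3 h4 hs =>
    obtain ⟨j, rfl⟩ := Nat.exists_eq_add_of_le' h1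
    refine ⟨?_, ?_, ?_, ?_, ?_⟩
    · simp [List.pairwise_cons, List.pairwise_replicate]; omega
    · simp; omega
    · simp; omega
    · simp [List.replicate_succ]; omega
    · simp [List.replicate_succ]
  | C a i j h1 h2 h3 hs =>
    obtain ⟨i, rfl⟩ := Nat.exists_eq_add_of_le' h1
    refine ⟨?_, ?_, ?_, ?_, ?_⟩
    · simp [List.pairwise_cons, List.pairwise_append, List.pairwise_replicate]; omega
    · simp; omega
    · simp; omega
    · simp [List.replicate_succ]; omega
    · simp [List.replicate_succ]
  | D i j k h1 h2 hs =>
    obtain ⟨i, rfl⟩ := Nat.exists_eq_add_of_le' h1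
    refine ⟨?_, ?_, ?_, ?_, ?_⟩
    · simp [List.pairwise_append, List.pairwise_replicate]; omega
    · simp; omega
    · simp; omega
    · rcases i with _ | i
      · obtain ⟨j, rfl⟩ := Nat.exists_eq_add_of_le' (show 1 ≤ j by omega)
        simp [List.replicate_succ]
      · simp [List.replicate_succ]
    · simp [List.replicate_succ]

theorem shape_of_good {n : ℕ} (hn : 9 < n) {l : List ℕ} (h : Good n l) : Shape n l := by
  obtain ⟨hs, h0, hsum, h3, h4⟩ := h
  match l, hs, h0, hsum, h3, h4 with
  | [], hs, h0, hsum, h3, h4 => simp at h3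
  | [_], hs, h0, hsum, h3, h4 => simp at h3
  | [_, _], hs, h0, hsum, h3, h4 => simp at h3
  | [a, b, c], hs, h0, hsum, h3, h4 =>
    simp at hs h0 hsum h3
    exact Shape.A a b c (by omega) (by omega) (by omega) (by omega) (by omega)
  | a :: b :: c :: d :: l, hs, h0, hsum, h3, h4 =>
    have hd := h0 d (by simp)
    simp at h3 h4
    have hs1 := List.pairwise_cons.1 hs
    have hs2 := List.pairwise_cons.1 hs1.2
    have hs3 := List.pairwise_cons.1 hs2.2
    have hab := hs1.1 b (by simp)
    have hbc := hs2.1 c (by simp)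
    by_cases hc : c ≤ 1
    · obtain ⟨j, hj⟩ := all_one (c :: d :: l)
        (fun x hx => h0 x (List.mem_cons_of_mem _ (List.mem_cons_of_mem _ hx))) (by
        intro y hy
        rcases List.mem_cons.1 hy with h | h
        · omega
        · have := hs3.1 y h; omega)
      have hlen := congrArg List.length hj
      rw [hj] at hsum ⊢
      simp at hlen hsum
      exact Shape.B a b j (by omega) (by omega) (by omega) (by omega) (by omega)
    by_cases hb : b ≤ 2
    · obtain ⟨i, j, hj⟩ := all_two (b :: c :: d :: l) hs1.2
        (fun x hx => h0 x (List.mem_cons_of_mem _ hx)) (by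
        intro y hy
        rcases List.mem_cons.1 hy with h | h
        · omega
        · have := hs2.1 y h; omega)
      have hlen := congrArg List.length hj
      have hi : 2 ≤ i := by
        rcases i with _ | _ | i
        · rcases j with _ | j <;> simp [List.replicate_succ] at hj; omega
        · rcases j with _ | j <;> simp [List.replicate_succ] at hj; omega
        · omega
      rw [hj] at hsum ⊢
      simp at hlen hsum
      exact Shape.C a i j (by omega) (by omega) (by omega) (by omega)
    · have ha : a ≤ 3 := by by_contra; apply absurd hd; have := h4 (by omega) (by omega) (by omega); omega
      obtain ⟨i, j, k, hj⟩ := all_three (a :: b :: c :: d :: l) hs h0 (by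
        intro y hy
        rcases List.mem_cons.1 hy with h | h
        · omega
        · have := hs1.1 y h; omega)
      have hi : 2 ≤ i ∧ 3 ≤ i + j := by
        rcases i with _ | _ | _ | i
        · rcases j with _ | j
          · rcases k with _ | k <;> simp [List.replicate_succ] at hj; omega
          · simp [List.replicate_succ] at hj; omega
        · rcases j with _ | j
          · rcases k with _ | k <;> simp [List.replicate_succ] at hj; omega
          · simp [List.replicate_succ] at hj; omega
        · rcases j with _ | j
          · rcases k with _ | k <;> simp [List.replicate_succ] at hj; omega
          · omega
        · omega
      rw [hj] at hsum ⊢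
      simp at hsum
      exact Shape.D i j k (by omega) (by omega) (by omega)

/-- Index sets. -/
def TS (a k : ℕ) : Finset (Σ _ : ℕ, ℕ) :=
  (Finset.range k).sigma fun t => Finset.range ((a + 3 * t) / 2 + 1)

def TV (k : ℕ) : Finset (Σ _ : ℕ, ℕ) :=
  (Finset.range k).sigma fun u => Finset.range (u / 2 + 1)

theorem card_TS (a k : ℕ) :
    2 * ((TS a (k + 1)).card + (TS a k).card : ℤ) =
      2 * (a / 2 : ℕ) + 2 + 2 * a * k + 3 * k * (k - 1) + 6 * k := by
  have hc : ∀ k, (TS a (k + 1)).card = (TS a k).card + ((a + 3 * k) / 2 + 1) := by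
    intro k; simp [TS, Finset.card_sigma, Finset.sum_range_succ]
  induction k with
  | zero => rw [hc]; simp [TS]; ring
  | succ k ih =>
    have e : (((a + 3 * k) / 2 : ℕ) : ℤ) + ((a + 3 * (k + 1)) / 2 : ℕ) = a + 3 * k + 1 := by omega
    rw [hc (k + 1), hc k]
    rw [hc k] at ih
    push_cast at ih e ⊢
    linarith

theorem card_TV (k : ℕ) :
    2 * ((TV (k + 1)).card + (TV k).card : ℤ) = (k + 1) * (k + 2) := by
  have hc : ∀ k, (TV (k + 1)).card = (TV k).card + (k / 2 + 1) := by
    intro k; simp [TV, Finset.card_sigma, Finset.sum_range_succ]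
  induction k with
  | zero => simp [TV, Finset.card_sigma]
  | succ k ih =>
    have e : ((k / 2 : ℕ) : ℤ) + ((k + 1) / 2 : ℕ) = k := by omega
    rw [hc (k + 1), hc k]
    rw [hc k] at ih
    push_cast at ih e ⊢
    linarith

def fA (n m : ℕ) (x : Σ _ : ℕ, ℕ) : List ℕ :=
  [n - 2 * (m - x.1) - x.2, (m - x.1) + x.2, m - x.1]
def fB (n : ℕ) (x : Σ _ : ℕ, ℕ) : List ℕ :=
  (x.1 + 2 - x.2) :: (2 + x.2) :: List.replicate (n - 4 - x.1) 1
def fC (n : ℕ) (x : Σ _ : ℕ, ℕ) : List ℕ :=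
  (n - 4 - x.1) :: (List.replicate (x.2 + 2) 2 ++ List.replicate (x.1 - 2 * x.2) 1)
def fD (a m : ℕ) (x : Σ _ : ℕ, ℕ) : List ℕ :=
  List.replicate (m - x.1) 3 ++ (List.replicate x.2 2 ++ List.replicate (a + 3 * x.1 - 2 * x.2) 1)

theorem final (n m a : ℕ) (hn : 9 < n) (ha : a < 3) (hma : n = 3 * m + a) :
    R 3 n + 4 = (TS a m).card + (TS a (m - 1)).card + (TV (n - 5)).card + (TV (n - 6)).card := by
  classical
  let TA := (TS a m).erase ⟨m - 1, 0⟩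
  let TD := (TS a (m - 1)).erase ⟨m - 2, 0⟩
  let TB := (TV (n - 5)).erase ⟨0, 0⟩
  let TC := (TV (n - 6)).erase ⟨0, 0⟩
  have cA : TA.card + 1 = (TS a m).card :=
    Finset.card_erase_add_one (by simp [TS]; omega)
  have cD : TD.card + 1 = (TS a (m - 1)).card :=
    Finset.card_erase_add_one (by simp [TS]; omega)
  have cB : TB.card + 1 = (TV (n - 5)).card :=
    Finset.card_erase_add_one (by simp [TV]; omega)
  have cC : TC.card + 1 = (TV (n - 6)).card :=
    Finset.card_erase_add_one (by simp [TV]; omega)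
  have mA : ∀ x y, (⟨x, y⟩ : Σ _ : ℕ, ℕ) ∈ TA ↔
      (x < m ∧ 2 * y ≤ a + 3 * x) ∧ ¬ (x = m - 1 ∧ y = 0) := by
    intro x y; simp [TA, TS]; omega
  have mD : ∀ x y, (⟨x, y⟩ : Σ _ : ℕ, ℕ) ∈ TD ↔
      (x < m - 1 ∧ 2 * y ≤ a + 3 * x) ∧ ¬ (x = m - 2 ∧ y = 0) := by
    intro x y; simp [TD, TS]; omega
  have mB : ∀ x y, (⟨x, y⟩ : Σ _ : ℕ, ℕ) ∈ TB ↔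
      (x < n - 5 ∧ 2 * y ≤ x) ∧ ¬ (x = 0 ∧ y = 0) := by
    intro x y; simp [TB, TV]; omega
  have mC : ∀ x y, (⟨x, y⟩ : Σ _ : ℕ, ℕ) ∈ TC ↔
      (x < n - 6 ∧ 2 * y ≤ x) ∧ ¬ (x = 0 ∧ y = 0) := by
    intro x y; simp [TC, TV]; omega
  have iA : (TA.image (fA n m)).card = TA.card := by
    apply Finset.card_image_of_injOn
    rintro ⟨x, y⟩ h ⟨x', y'⟩ h' e
    rw [Finset.mem_coe, mA] at h h'
    simp [fA] at e
    obtain rfl : x = x' := by omega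
    obtain rfl : y = y' := by omega
    rfl
  have iB : (TB.image (fB n)).card = TB.card := by
    apply Finset.card_image_of_injOn
    rintro ⟨x, y⟩ h ⟨x', y'⟩ h' e
    rw [Finset.mem_coe, mB] at h h'
    simp [fB] at e
    obtain rfl : x = x' := by omega
    obtain rfl : y = y' := by omega
    rfl
  have iC : (TC.image (fC n)).card = TC.card := by
    apply Finset.card_image_of_injOn
    rintro ⟨x, y⟩ h ⟨x', y'⟩ h' e
    rw [Finset.mem_coe, mC] at h h'
    simp only [fC, List.cons.injEq] at e
    have e2 := congrArg (List.count 2) e.2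
    simp [List.count_append, List.count_replicate] at e2
    obtain rfl : x = x' := by omega
    obtain rfl : y = y' := by omega
    rfl
  have iD : (TD.image (fD a m)).card = TD.card := by
    apply Finset.card_image_of_injOn
    rintro ⟨x, y⟩ h ⟨x', y'⟩ h' e
    rw [Finset.mem_coe, mD] at h h'
    simp only [fD] at e
    have e2 := congrArg (List.count 2) e
    have e3 := congrArg (List.count 3) e
    simp [List.count_append, List.count_replicate] at e2 e3
    obtain rfl : x = x' := by omega
    obtain rfl : y = y' := by omega
    rfl
  -- distinguishing features
  have dA : ∀ l ∈ TA.image (fA n m), l.getD 3 0 = 0 := by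
    intro l hl
    obtain ⟨⟨x, y⟩, h, rfl⟩ := Finset.mem_image.1 hl
    simp [fA]
  have dB : ∀ l ∈ TB.image (fB n), l.getD 3 0 = 1 ∧ l.getD 2 0 = 1 := by
    intro l hl
    obtain ⟨⟨x, y⟩, h, rfl⟩ := Finset.mem_image.1 hl
    rw [mB] at h
    obtain ⟨j, hj⟩ := Nat.exists_eq_add_of_le' (show 2 ≤ n - 4 - x by omega)
    simp [fB, hj, List.replicate_succ]
  have dC : ∀ l ∈ TC.image (fC n), l.getD 3 0 ≠ 0 ∧ l.getD 2 0 = 2 ∧ l.getD 1 0 = 2 := by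
    intro l hl
    obtain ⟨⟨x, y⟩, h, rfl⟩ := Finset.mem_image.1 hl
    rw [mC] at h
    rcases y with _ | y
    · obtain ⟨j, hj⟩ := Nat.exists_eq_add_of_le' (show 1 ≤ x by omega)
      simp [fC, hj, List.replicate_succ]
    · simp [fC, List.replicate_succ]
  have dD : ∀ l ∈ TD.image (fD a m), l.getD 3 0 ≠ 0 ∧ 2 ≤ l.getD 2 0 ∧ l.getD 1 0 = 3 := by
    intro l hl
    obtain ⟨⟨x, y⟩, h, rfl⟩ := Finset.mem_image.1 hl
    rw [mD] at h
    simp only [fD]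
    generalize hk : a + 3 * x - 2 * y = k
    obtain ⟨i, hi⟩ := Nat.exists_eq_add_of_le' (show 2 ≤ m - x by omega)
    rw [hi]
    rcases i with _ | _ | i
    · rcases y with _ | _ | y
      · omega
      · rcases k with _ | k
        · omega
        · simp [List.replicate_succ]
      · simp [List.replicate_succ]
    · rcases y with _ | y
      · rcases k with _ | k
        · omega
        · simp [List.replicate_succ]
      · simp [List.replicate_succ]
    · simp [List.replicate_succ]
  have key := R_three_card hn
    (((TA.image (fA n m) ∪ TB.image (fB n)) ∪ TC.image (fC n)) ∪ TD.image (fD a m)) (by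
    intro l
    constructor
    · intro hl
      apply good_of_shape hn
      simp only [Finset.mem_union, Finset.mem_image] at hl
      rcases hl with ((⟨⟨x, y⟩, h, rfl⟩ | ⟨⟨x, y⟩, h, rfl⟩) | ⟨⟨x, y⟩, h, rfl⟩) | ⟨⟨x, y⟩, h, rfl⟩
      · rw [mA] at h
        apply Shape.A <;> simp only <;> omega
      · rw [mB] at h
        apply Shape.B <;> simp only <;> omega
      · rw [mC] at h
        apply Shape.C <;> simp only <;> omega
      · rw [mD] at h
        apply Shape.D <;> simp only <;> omega
    · intro hl
      simp only [Finset.mem_union, Finset.mem_image]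
      cases shape_of_good hn hl with
      | A p q c h1 h2 h3 h4 hs =>
        refine Or.inl (Or.inl (Or.inl ⟨⟨m - c, q - c⟩, (mA _ _).2 (by omega), ?_⟩))
        simp [fA]; omega
      | B p q j h1 h2 h3 h4 hs =>
        refine Or.inl (Or.inl (Or.inr ⟨⟨n - 4 - j, q - 2⟩, (mB _ _).2 (by omega), ?_⟩))
        simp [fB]; omega
      | C p i j h1 h2 h3 hs =>
        refine Or.inl (Or.inr ⟨⟨n - 4 - p, i - 2⟩, (mC _ _).2 (by omega), ?_⟩)
        simp only [fC]
        congr 1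
        · omega
        · congr 2 <;> omega
      | D i j k h1 h2 hs =>
        refine Or.inr ⟨⟨m - i, j⟩, (mD _ _).2 (by omega), ?_⟩
        simp only [fD]
        congr 2
        · omega
        · congr 1; omega)
  rw [Finset.card_union_of_disjoint, Finset.card_union_of_disjoint,
    Finset.card_union_of_disjoint, iA, iB, iC, iD] at key
  · omega
  · rw [Finset.disjoint_left]
    intro l h1 h2
    have := dA l h1; have := dB l h2; omega
  · rw [Finset.disjoint_left]
    intro l h1 h2
    have := dC l h2
    rcases Finset.mem_union.1 h1 with h1 | h1
    · have := dA l h1; omega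
    · have := dB l h1; omega
  · rw [Finset.disjoint_left]
    intro l h1 h2
    have := dD l h2
    simp only [Finset.mem_union] at h1
    rcases h1 with (h1 | h1) | h1
    · have := dA l h1; omega
    · have := dB l h1; omega
    · have := dC l h1; omega

end DT

theorem R_three_formula (n m a : ℕ) (hn : 9 < n) (ha : a < 3) (hma : n = 3 * m + a) :
    (a = 0 → (R 3 n : ℤ) = 6 * m ^ 2 - 15 * m + 7) ∧
    (a = 1 → (R 3 n : ℤ) = 6 * m ^ 2 - 11 * m + 2) ∧
    (a = 2 → (R 3 n : ℤ) = 6 * m ^ 2 - 7 * m - 1) := by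
  have h := DT.final n m a hn ha hma
  obtain ⟨k, rfl⟩ := Nat.exists_eq_add_of_le' (show 1 ≤ m by omega)
  obtain ⟨r, rfl⟩ := Nat.exists_eq_add_of_le' (show 6 ≤ n by omega)
  have hS := DT.card_TS a k
  have hV := DT.card_TV r
  have e1 : r + 6 - 5 = r + 1 := by omega
  have e2 : r + 6 - 6 = r := by omega
  have e3 : k + 1 - 1 = k := by omega
  rw [e1, e2, e3] at h
  zify at h
  have hr : (r : ℤ) = 3 * k + a - 3 := by omega
  rw [hr] at hV
  refine ⟨?_, ?_, ?_⟩ <;> rintro rfl <;> push_cast at hS hV h ⊢ <;> norm_num at hS hV <;> linarith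
end

section
/- For every integer p ≥ 2 and every n > 9, R_3(n + 3p) ≡ R_3(n) (mod p); that is, R_3 modulo p is periodic with period 3p. -/
def T3 (l : List ℕ) : Prop :=
  3 ≤ l.getD 0 0 ∧ 2 ≤ l.getD 1 0 ∧ 1 ≤ l.getD 2 0 ∧
  ¬ (4 ≤ l.getD 0 0 ∧ 3 ≤ l.getD 1 0 ∧ 2 ≤ l.getD 2 0 ∧ 1 ≤ l.getD 3 0)

def Good (n : ℕ) (l : List ℕ) : Prop :=
  l.Pairwise (· ≥ ·) ∧ (∀ x ∈ l, 0 < x) ∧ l.sum = n ∧ T3 l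

lemma durfee_three {n : ℕ} (hn : 4 ≤ n) (p : n.Partition) :
    durfee p = 3 ↔ T3 (p.parts.sort (· ≥ ·)) := by
  classical
  unfold durfee
  refine (@Nat.findGreatest_eq_iff _ _ _ (fun _ => Classical.propDecidable _)).trans ?_
  have h3 : (∀ i ∈ Finset.Icc 1 3, 3 + 1 ≤ part p i + i) ↔
      (3 ≤ part p 1 ∧ 2 ≤ part p 2 ∧ 1 ≤ part p 3) := by
    constructor
    · intro h
      have h1 := h 1 (by simp)
      have h2 := h 2 (by simp)
      have h3 := h 3 (by simp)
      omega
    · intro h i hi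
      simp only [Finset.mem_Icc] at hi
      obtain ⟨h1, h2⟩ := hi
      interval_cases i <;> omega
  have h4 : (∀ i ∈ Finset.Icc 1 4, 4 + 1 ≤ part p i + i) ↔
      (4 ≤ part p 1 ∧ 3 ≤ part p 2 ∧ 2 ≤ part p 3 ∧ 1 ≤ part p 4) := by
    constructor
    · intro h
      have h1 := h 1 (by simp)
      have h2 := h 2 (by simp)
      have h3 := h 3 (by simp)
      have h4 := h 4 (by simp)
      omega
    · intro h i hi
      simp only [Finset.mem_Icc] at hi
      obtain ⟨h1, h2⟩ := hi
      interval_cases i <;> omega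
  have hT : T3 (p.parts.sort (· ≥ ·)) ↔ (3 ≤ part p 1 ∧ 2 ≤ part p 2 ∧ 1 ≤ part p 3) ∧
      ¬ (4 ≤ part p 1 ∧ 3 ≤ part p 2 ∧ 2 ≤ part p 3 ∧ 1 ≤ part p 4) := by
    unfold T3 part
    simp only [and_assoc, Nat.sub_self, Nat.reduceSub]
  rw [hT, ← h3, ← h4]
  constructor
  · rintro ⟨_, h, h'⟩
    exact ⟨h (by norm_num), h' (by norm_num) hn⟩
  · rintro ⟨h, h'⟩
    refine ⟨by omega, fun _ => h, ?_⟩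
    intro k hk hkn hP
    apply h'
    intro i hi
    simp only [Finset.mem_Icc] at hi
    have := hP i (by simp only [Finset.mem_Icc]; omega)
    omega

lemma R_eq_card {n : ℕ} (hn : 4 ≤ n) (S : Finset (List ℕ)) (hS : ∀ l, l ∈ S ↔ Good n l) :
    R 3 n = S.card := by
  classical
  unfold R
  apply Finset.card_bij (fun p _ => p.parts.sort (· ≥ ·))
  · intro p hp
    rw [hS]
    refine ⟨Multiset.pairwise_sort _ _, ?_, ?_, ?_⟩
    · intro x hx
      exact p.parts_pos (by simpa using hx)
    · rw [← Multiset.sum_coe, Multiset.sort_eq, p.parts_sum]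
    · exact (durfee_three hn p).1 (by simpa using hp)
  · intro p _ q _ h
    have := congrArg (fun l : List ℕ => (l : Multiset ℕ)) h
    simp only [Multiset.sort_eq] at this
    exact Nat.Partition.ext this
  · intro l hl
    rw [hS] at hl
    obtain ⟨h1, h2, h3, h4⟩ := hl
    have hs : (l : Multiset ℕ).sort (· ≥ ·) = l := by
      apply List.Perm.eq_of_pairwise' (r := (· ≥ ·))
      · exact Multiset.pairwise_sort _ _
      · exact h1
      · exact Multiset.coe_eq_coe.1 (Multiset.sort_eq _ _)
    refine ⟨⟨(l : Multiset ℕ), fun {i} hi => h2 i (by simpa using hi), by simpa using h3⟩, ?_, hs⟩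
    simp only [Finset.mem_filter, Finset.mem_univ, true_and]
    rw [durfee_three hn]
    simpa [hs] using h4

def SA (n : ℕ) : Finset (ℕ × ℕ) := (Finset.range (n+1) ×ˢ Finset.range (n+1)).filter
  fun x => 1 ≤ x.2 ∧ x.2 ≤ x.1 ∧ 2 ≤ x.1 ∧ 2 * x.1 + x.2 ≤ n ∧ x.1 + x.2 + 3 ≤ n
def SB (n : ℕ) : Finset (ℕ × ℕ) := (Finset.range (n+1) ×ˢ Finset.range (n+1)).filter
  fun x => 3 ≤ x.1 ∧ x.2 ≤ x.1 ∧ 2 ≤ x.2 ∧ x.1 + x.2 + 2 ≤ n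
def SC (n : ℕ) : Finset (ℕ × ℕ) := (Finset.range (n+1) ×ˢ Finset.range (n+1)).filter
  fun x => 1 ≤ x.1 + x.2 ∧ 2 * x.1 + x.2 + 7 ≤ n
def SD (n : ℕ) : Finset (ℕ × ℕ) := (Finset.range (n+1) ×ˢ Finset.range (n+1)).filter
  fun x => 1 ≤ x.1 + x.2 ∧ 3 * x.1 + 2 * x.2 + 6 ≤ n ∧
    2 ≤ x.1 + x.2 + (n - 6 - 3 * x.1 - 2 * x.2)

lemma mem_SA {n a b : ℕ} : (a, b) ∈ SA n ↔
    1 ≤ b ∧ b ≤ a ∧ 2 ≤ a ∧ 2 * a + b ≤ n ∧ a + b + 3 ≤ n := by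
  simp only [SA, Finset.mem_filter, Finset.mem_product, Finset.mem_range]; omega
lemma mem_SB {n a b : ℕ} : (a, b) ∈ SB n ↔ 3 ≤ a ∧ b ≤ a ∧ 2 ≤ b ∧ a + b + 2 ≤ n := by
  simp only [SB, Finset.mem_filter, Finset.mem_product, Finset.mem_range]; omega
lemma mem_SC {n a b : ℕ} : (a, b) ∈ SC n ↔ 1 ≤ a + b ∧ 2 * a + b + 7 ≤ n := by
  simp only [SC, Finset.mem_filter, Finset.mem_product, Finset.mem_range]; omega
lemma mem_SD {n a b : ℕ} : (a, b) ∈ SD n ↔ 1 ≤ a + b ∧ 3 * a + 2 * b + 6 ≤ n ∧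
    2 ≤ a + b + (n - 6 - 3 * a - 2 * b) := by
  simp only [SD, Finset.mem_filter, Finset.mem_product, Finset.mem_range]; omega

lemma card_SA {n : ℕ} (hn : 9 < n) : (SA (n+3)).card = (SA n).card + (n / 2 + 1) := by
  have h : SA (n+3) = (SA n).image (fun x => (x.1+1, x.2+1)) ∪
      ((Finset.Icc 2 ((n+2)/2)).image (fun b => (b, 1)) ∪ {(2,2)}) := by
    ext ⟨a, b⟩
    simp only [Finset.mem_union, Finset.mem_image, Finset.mem_singleton, Prod.exists, mem_SA,
      Prod.mk.injEq, Finset.mem_Icc]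
    constructor
    · intro h
      by_cases h1 : b = 1
      · exact Or.inr (Or.inl ⟨a, by omega, by omega⟩)
      · by_cases h2 : a = 2
        · exact Or.inr (Or.inr (by omega))
        · exact Or.inl ⟨a-1, b-1, by omega, by omega⟩
    · rintro (⟨x, y, h⟩ | ⟨x, h⟩ | h) <;> omega
  rw [h, Finset.card_union_of_disjoint, Finset.card_union_of_disjoint, Finset.card_image_of_injective,
    Finset.card_image_of_injective, Nat.card_Icc, Finset.card_singleton]
  · omega
  · intro x y; simp
  · rintro ⟨x, y⟩ ⟨z, w⟩; simp
  · simp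
  · rw [Finset.disjoint_left]
    rintro ⟨a, b⟩
    simp only [Finset.mem_union, Finset.mem_image, Finset.mem_singleton, Prod.exists, mem_SA,
      Prod.mk.injEq, Finset.mem_Icc]
    rintro ⟨x, y, h⟩ (⟨z, h⟩ | h) <;> omega

lemma card_SB {n : ℕ} (hn : 9 < n) : (SB (n+1)).card = (SB n).card + ((n-1) / 2 - 1) := by
  have h : SB (n+1) = SB n ∪ (Finset.Icc 2 ((n-1)/2)).image (fun b => (n-1-b, b)) := by
    ext ⟨a, b⟩
    simp only [Finset.mem_union, Finset.mem_image, mem_SB, Prod.mk.injEq, Finset.mem_Icc]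
    constructor
    · intro h
      by_cases h1 : a + b + 2 ≤ n
      · left; omega
      · exact Or.inr ⟨b, by omega, by omega⟩
    · rintro (h | ⟨x, h⟩) <;> omega
  rw [h, Finset.card_union_of_disjoint, Finset.card_image_of_injective, Nat.card_Icc]
  · omega
  · intro x y; simp
  · rw [Finset.disjoint_left]
    rintro ⟨a, b⟩
    simp only [Finset.mem_image, mem_SB, Prod.mk.injEq, Finset.mem_Icc]
    rintro h ⟨z, h⟩; omega

lemma card_SC {n : ℕ} (hn : 9 < n) : (SC (n+1)).card = (SC n).card + ((n-6) / 2 + 1) := by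
  have h : SC (n+1) = SC n ∪ (Finset.range ((n-6)/2+1)).image (fun i => (i, n-6-2*i)) := by
    ext ⟨a, b⟩
    simp only [Finset.mem_union, Finset.mem_image, mem_SC, Prod.mk.injEq, Finset.mem_range]
    constructor
    · intro h
      by_cases h1 : 2 * a + b + 7 ≤ n
      · left; omega
      · exact Or.inr ⟨a, by omega, by omega⟩
    · rintro (h | ⟨x, h⟩) <;> omega
  rw [h, Finset.card_union_of_disjoint, Finset.card_image_of_injective, Finset.card_range]
  · intro x y; simp; omega
  · rw [Finset.disjoint_left]
    rintro ⟨a, b⟩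
    simp only [Finset.mem_image, mem_SC, Prod.mk.injEq, Finset.mem_range]
    rintro h ⟨z, h⟩; omega

lemma card_SD {n : ℕ} (hn : 9 < n) : (SD (n+3)).card = (SD n).card + ((n-3) / 2 + 1) := by
  have h : SD (n+3) = (SD n).image (fun x => (x.1+1, x.2)) ∪
      ((Finset.Icc 1 ((n-3)/2)).image (fun b => (0, b)) ∪ {(1,0)}) := by
    ext ⟨a, b⟩
    simp only [Finset.mem_union, Finset.mem_image, Finset.mem_singleton, Prod.exists, mem_SD,
      Prod.mk.injEq, Finset.mem_Icc]
    constructor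
    · intro h
      by_cases h1 : a = 0
      · exact Or.inr (Or.inl ⟨b, by omega, by omega⟩)
      · by_cases h2 : a = 1 ∧ b = 0
        · exact Or.inr (Or.inr (by omega))
        · exact Or.inl ⟨a-1, b, by omega, by omega⟩
    · rintro (⟨x, y, h⟩ | ⟨x, h⟩ | h) <;> omega
  rw [h, Finset.card_union_of_disjoint, Finset.card_union_of_disjoint, Finset.card_image_of_injective,
    Finset.card_image_of_injective, Nat.card_Icc, Finset.card_singleton]
  · omega
  · intro x y; simp
  · rintro ⟨x, y⟩ ⟨z, w⟩; simp
  · simp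
  · rw [Finset.disjoint_left]
    rintro ⟨a, b⟩
    simp only [Finset.mem_union, Finset.mem_image, Finset.mem_singleton, Prod.exists, mem_SD,
      Prod.mk.injEq, Finset.mem_Icc]
    rintro ⟨x, y, h⟩ (⟨z, h⟩ | h) <;> omega

def fA (n : ℕ) (x : ℕ × ℕ) : List ℕ := [n - x.1 - x.2, x.1, x.2]
def fB (n : ℕ) (x : ℕ × ℕ) : List ℕ :=
  x.1 :: x.2 :: 1 :: List.replicate (n - 1 - x.1 - x.2) 1
def fC (n : ℕ) (x : ℕ × ℕ) : List ℕ :=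
  (n - 4 - 2 * x.1 - x.2) :: 2 :: 2 :: (List.replicate x.1 2 ++ List.replicate x.2 1)
def fD (n : ℕ) (x : ℕ × ℕ) : List ℕ :=
  3 :: 3 :: (List.replicate x.1 3 ++ (List.replicate x.2 2 ++
    List.replicate (n - 6 - 3 * x.1 - 2 * x.2) 1))

/-- Good lists. -/
def SS (n : ℕ) : Finset (List ℕ) :=
  (SA n).image (fA n) ∪ ((SB n).image (fB n) ∪ ((SC n).image (fC n) ∪ (SD n).image (fD n)))

lemma ones (l : List ℕ) (hp : ∀ x ∈ l, 0 < x) (h : ∀ x ∈ l, x ≤ 1) :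
    l = List.replicate l.sum 1 := by
  have h1 : l = List.replicate l.length 1 :=
    List.eq_replicate_iff.2 ⟨rfl, fun x hx => by have := hp x hx; have := h x hx; omega⟩
  have h2 : l.sum = l.length := by
    conv_lhs => rw [h1]
    simp
  rw [h2]; exact h1

lemma twos (l : List ℕ) (hs : l.Pairwise (· ≥ ·)) (hp : ∀ x ∈ l, 0 < x) (h : ∀ x ∈ l, x ≤ 2) :
    ∃ i j, l = List.replicate i 2 ++ List.replicate j 1 := by
  induction l with
  | nil => exact ⟨0, 0, rfl⟩
  | cons a t ih =>
    rw [List.pairwise_cons] at hs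
    simp only [List.forall_mem_cons] at hp h
    by_cases ha : a = 2
    · obtain ⟨i, j, e⟩ := ih hs.2 hp.2 h.2
      exact ⟨i+1, j, by rw [ha, e, List.replicate_succ, List.cons_append]⟩
    · have ha : a = 1 := by omega
      refine ⟨0, t.sum + 1, ?_⟩
      have := ones t hp.2 (fun x hx => by have := hs.1 x hx; omega)
      rw [List.replicate_succ, ← this, ha]; rfl

lemma threes (l : List ℕ) (hs : l.Pairwise (· ≥ ·)) (hp : ∀ x ∈ l, 0 < x) (h : ∀ x ∈ l, x ≤ 3) :
    ∃ i j k, l = List.replicate i 3 ++ (List.replicate j 2 ++ List.replicate k 1) := by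
  induction l with
  | nil => exact ⟨0, 0, 0, rfl⟩
  | cons a t ih =>
    by_cases ha : a = 3
    · rw [List.pairwise_cons] at hs
      simp only [List.forall_mem_cons] at hp h
      obtain ⟨i, j, k, e⟩ := ih hs.2 hp.2 h.2
      exact ⟨i+1, j, k, by rw [ha, e, List.replicate_succ, List.cons_append]⟩
    · obtain ⟨i, j, e⟩ := twos (a :: t) hs hp (by
        rw [List.pairwise_cons] at hs
        simp only [List.forall_mem_cons] at hp h ⊢
        refine ⟨by omega, fun x hx => ?_⟩
        have := hs.1 x hx
        omega)
      exact ⟨0, i, j, by simpa using e⟩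

lemma good_A {n a b : ℕ} (h : (a, b) ∈ SA n) : Good n (fA n (a, b)) := by
  rw [mem_SA] at h
  simp [Good, fA, T3]
  omega

lemma good_B {n a b : ℕ} (h : (a, b) ∈ SB n) : Good n (fB n (a, b)) := by
  rw [mem_SB] at h
  refine ⟨?_, ?_, ?_, ?_⟩
  · simp only [fB, List.pairwise_cons, List.forall_mem_cons, List.mem_replicate,
      List.pairwise_replicate]
    refine ⟨⟨by omega, by omega, ?_⟩, ⟨by omega, ?_⟩, ?_, by simp⟩ <;> (intro x hx; omega)
  · simp only [fB, List.forall_mem_cons, List.mem_replicate]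
    refine ⟨by omega, by omega, by omega, ?_⟩
    intro x hx; omega
  · simp [fB]; omega
  · simp [fB, T3]; omega

lemma good_C {n a b : ℕ} (h : (a, b) ∈ SC n) : Good n (fC n (a, b)) := by
  rw [mem_SC] at h
  refine ⟨?_, ?_, ?_, ?_⟩
  · simp only [fC, List.pairwise_cons, List.forall_mem_cons, List.mem_replicate,
      List.pairwise_replicate, List.pairwise_append, List.mem_append]
    refine ⟨⟨by omega, by omega, ?_⟩, ⟨by omega, ?_⟩, ?_, by simp, by simp, ?_⟩
    · intro x hx; omega
    · intro x hx; omega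
    · intro x hx; omega
    · intro x hx y hy; omega
  · simp only [fC, List.forall_mem_cons, List.mem_replicate, List.mem_append]
    refine ⟨by omega, by omega, by omega, ?_⟩
    intro x hx; omega
  · simp [fC]; omega
  · simp [fC, T3]; omega

lemma good_D {n a b : ℕ} (h : (a, b) ∈ SD n) : Good n (fD n (a, b)) := by
  rw [mem_SD] at h
  refine ⟨?_, ?_, ?_, ?_⟩
  · simp only [fD, List.pairwise_cons, List.forall_mem_cons, List.mem_replicate,
      List.pairwise_replicate, List.pairwise_append, List.mem_append]
    refine ⟨⟨by omega, ?_⟩, ?_, by simp, ⟨by simp, by simp, ?_⟩, ?_⟩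
    · intro x hx; omega
    · intro x hx; omega
    · intro x hx y hy; omega
    · intro x hx y hy; omega
  · simp only [fD, List.forall_mem_cons, List.mem_replicate, List.mem_append]
    refine ⟨by omega, by omega, ?_⟩
    intro x hx; omega
  · simp [fD]; omega
  · obtain _ | a := a
    · obtain _ | b := b
      · omega
      · simp [fD, T3, List.replicate_succ]
    · simp [fD, T3, List.replicate_succ]

lemma mem_SS {n : ℕ} (hn : 9 < n) (l : List ℕ) : l ∈ SS n ↔ Good n l := by
  simp only [SS, Finset.mem_union, Finset.mem_image, Prod.exists]
  constructor
  · rintro (⟨a, b, h, rfl⟩ | ⟨a, b, h, rfl⟩ | ⟨a, b, h, rfl⟩ | ⟨a, b, h, rfl⟩)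
    · exact good_A h
    · exact good_B h
    · exact good_C h
    · exact good_D h
  · rintro ⟨hs, hp, hsum, hT⟩
    obtain _ | ⟨a, _ | ⟨b, _ | ⟨c, _ | ⟨d, t⟩⟩⟩⟩ := l
    · simp [T3] at hT
    · simp [T3] at hT
    · simp [T3] at hT
    · left
      simp [T3] at hT hs hp hsum
      refine ⟨b, c, ?_, ?_⟩
      · rw [mem_SA]; omega
      · simp [fA]; omega
    · right
      have hs' := hs
      have hp' := hp
      simp only [List.pairwise_cons, List.forall_mem_cons] at hs hp
      obtain ⟨⟨h1, h2, h3, h4⟩, ⟨h5, h6, h7⟩, ⟨h8, h9⟩, h10, h11⟩ := hs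
      simp [T3] at hT
      simp only [List.sum_cons] at hsum
      by_cases hc : c = 1
      · left
        have e := ones (d :: t) (by simp only [List.forall_mem_cons]; tauto) (by
          simp only [List.forall_mem_cons]
          refine ⟨by omega, fun x hx => ?_⟩
          have := h9 x hx
          omega)
        refine ⟨a, b, ?_, ?_⟩
        · rw [mem_SB]; omega
        · simp only [fB]
          rw [e, hc]
          have : n - 1 - a - b = (d :: t).sum := by simp only [List.sum_cons]; omega
          rw [this]
      · right
        by_cases hb : b = 2
        · left
          obtain ⟨i, j, e⟩ := twos (d :: t) (by simp only [List.pairwise_cons]; exact ⟨h10, h11⟩)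
            (by simp only [List.forall_mem_cons]; tauto) (by
            simp only [List.forall_mem_cons]
            refine ⟨by omega, fun x hx => ?_⟩
            have := h7 x hx
            omega)
          have e1 := congrArg List.sum e
          have e2 := congrArg List.length e
          simp at e1 e2
          refine ⟨i, j, ?_, ?_⟩
          · rw [mem_SC]; omega
          · simp only [fC]
            rw [e]
            congr 1
            · omega
            · congr 1
              · omega
              · congr 1; omega
        · right
          obtain ⟨i, j, k, e⟩ := threes (c :: d :: t)
            (by simp only [List.pairwise_cons, List.forall_mem_cons]; exact ⟨⟨h8, h9⟩, h10, h11⟩)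
            (by simp only [List.forall_mem_cons]; tauto) (by
            simp only [List.forall_mem_cons]
            refine ⟨by omega, by omega, fun x hx => ?_⟩
            have := h4 x hx
            omega)
          have e1 := congrArg List.sum e
          have e2 := congrArg List.length e
          simp at e1 e2
          have hij : 1 ≤ i + j := by
            by_contra hh
            have hi : i = 0 := by omega
            have hj : j = 0 := by omega
            subst hi hj
            have : c ∈ List.replicate k 1 := by
              have : c ∈ c :: d :: t := by simp
              rw [e] at this
              simpa using this
            exact hc (List.mem_replicate.1 this).2
          refine ⟨i, j, ?_, ?_⟩
          · rw [mem_SD]; omega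
          · simp only [fD]
            rw [e]
            have : n - 6 - 3 * i - 2 * j = k := by omega
            rw [this]
            congr 1
            · omega
            · congr 1
              omega

lemma card_SS {n : ℕ} (hn : 9 < n) :
    (SS n).card = (SA n).card + ((SB n).card + ((SC n).card + (SD n).card)) := by
  unfold SS
  rw [Finset.card_union_of_disjoint, Finset.card_union_of_disjoint, Finset.card_union_of_disjoint,
    Finset.card_image_of_injOn, Finset.card_image_of_injOn, Finset.card_image_of_injOn,
    Finset.card_image_of_injOn]
  · rintro ⟨a, b⟩ h ⟨c, d⟩ h' e
    have e1 := congrArg (List.count 2) e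
    have e2 := congrArg (List.count 3) e
    simp [fD, List.count_replicate] at e1 e2
    simp [e1, e2]
  · rintro ⟨a, b⟩ h ⟨c, d⟩ h' e
    simp only [fC, List.cons.injEq, true_and] at e
    have e1 := congrArg (List.count 2) e.2
    have e2 := congrArg (List.count 1) e.2
    simp [List.count_replicate] at e1 e2
    simp [e1, e2]
  · rintro ⟨a, b⟩ h ⟨c, d⟩ h' e
    simp only [fB, List.cons.injEq] at e
    simp [e.1, e.2.1]
  · rintro ⟨a, b⟩ h ⟨c, d⟩ h' e
    simp only [fA, List.cons.injEq] at e
    simp [e.2.1, e.2.2.1]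
  · rw [Finset.disjoint_left]
    intro l hl hl'
    simp only [Finset.mem_image, Prod.exists, mem_SC] at hl hl'
    obtain ⟨a, b, -, rfl⟩ := hl
    obtain ⟨c, d, -, h⟩ := hl'
    simp [fC, fD] at h
  · rw [Finset.disjoint_left]
    intro l hl hl'
    simp only [Finset.mem_union, Finset.mem_image, Prod.exists, mem_SC, mem_SD] at hl hl'
    obtain ⟨a, b, -, rfl⟩ := hl
    obtain ⟨c, d, -, h⟩ | ⟨c, d, h', h⟩ := hl'
    · simp [fC, fB] at h
    · obtain _ | c := c
      · obtain _ | d := d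
        · omega
        · simp [fD, fB, List.replicate_succ] at h
      · simp [fD, fB, List.replicate_succ] at h
  · rw [Finset.disjoint_left]
    intro l hl hl'
    simp only [Finset.mem_union, Finset.mem_image, Prod.exists, mem_SB, mem_SC, mem_SD] at hl hl'
    obtain ⟨a, b, -, rfl⟩ := hl
    obtain ⟨c, d, h', h⟩ | ⟨c, d, h', h⟩ | ⟨c, d, h', h⟩ := hl'
    all_goals
      have e := congrArg List.length h
      simp [fA, fB, fC, fD] at e
      omega

lemma R_step {n : ℕ} (hn : 9 < n) : R 3 (n + 3) = R 3 n + (4 * n - 9) := by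
  rw [R_eq_card (by omega) _ (mem_SS hn), R_eq_card (by omega) _ (mem_SS (by omega : 9 < n + 3)),
    card_SS hn, card_SS (by omega), card_SA hn, card_SD hn]
  have b1 := card_SB hn
  have b2 := card_SB (by omega : 9 < n + 1)
  have b3 := card_SB (by omega : 9 < n + 2)
  have c1 := card_SC hn
  have c2 := card_SC (by omega : 9 < n + 1)
  have c3 := card_SC (by omega : 9 < n + 2)
  simp only [Nat.add_assoc, Nat.reduceAdd] at b2 b3 c2 c3
  omega

lemma R_iter {n : ℕ} (hn : 9 < n) (t : ℕ) :
    (R 3 (n + 3 * t) : ℤ) = R 3 n + t * (4 * n - 9 + 6 * (t - 1)) := by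
  induction t with
  | zero => simp
  | succ t ih =>
    have h := R_step (by omega : 9 < n + 3 * t)
    have h' : (R 3 (n + 3 * (t + 1)) : ℤ) = R 3 (n + 3 * t) + (4 * (n + 3 * t) - 9) := by
      rw [show n + 3 * (t + 1) = n + 3 * t + 3 by ring, h]
      omega
    rw [h', ih]
    push_cast
    ring

theorem R_three_periodic (p n : ℕ) (hp : 2 ≤ p) (hn : 9 < n) :
    R 3 (n + 3 * p) ≡ R 3 n [MOD p] := by
  apply Nat.ModEq.symm
  rw [Nat.modEq_iff_dvd, R_iter hn]
  exact ⟨4 * n - 9 + 6 * (p - 1), by ring⟩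
end

section
/- For n > 16, write n = 12m + a with 0 ≤ a ≤ 11. Then R_4(n) equals: 192m³-264m²+87m-3 (a=0), 192m³-216m²+44m+5 (a=1), 192m³-168m²+15m+5 (a=2), 192m³-120m²-12m+7 (a=3), 192m³-72m²-25m+4 (a=4), 192m³-24m²-36m+3 (a=5), 192m³+24m²-33m-2 (a=6), 192m³+72m²-28m-3 (a=7), 192m³+120m²-9m-5 (a=8), 192m³+168m²+12m-5 (a=9), 192m³+216m²+47m-3 (a=10), 192m³+264m²+84m+3 (a=11). -/
lemma ncard_split {α : Type*} (S : Set (ℕ × α)) (hS : S.Finite) :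
    S.ncard = {t | (0, t) ∈ S}.ncard + {p : ℕ × α | (p.1 + 1, p.2) ∈ S}.ncard := by
  have i1 : Function.Injective (fun t : α => ((0 : ℕ), t)) := by
    intro a b h; simpa using h
  have i2 : Function.Injective (fun p : ℕ × α => (p.1 + 1, p.2)) := by
    rintro ⟨a, b⟩ ⟨c, d⟩ h; simpa using h
  have h1 := Set.ncard_image_of_injective {t | (0, t) ∈ S} i1
  have h2 := Set.ncard_image_of_injective {p : ℕ × α | (p.1 + 1, p.2) ∈ S} i2
  have f1 : ((fun t : α => ((0 : ℕ), t)) '' {t | (0, t) ∈ S}).Finite := hS.subset (by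
    rintro _ ⟨a, ha, rfl⟩
    exact ha)
  have f2 : ((fun p : ℕ × α => (p.1 + 1, p.2)) '' {p : ℕ × α | (p.1 + 1, p.2) ∈ S}).Finite :=
    hS.subset (by
    rintro _ ⟨a, ha, rfl⟩
    exact ha)
  rw [← h1, ← h2, ← Set.ncard_union_eq ?_ f1 f2]
  · congr 1
    ext ⟨x, t⟩
    cases x <;> simp
  · rw [Set.disjoint_left]
    rintro ⟨x, t⟩ ⟨a, _, ha⟩ ⟨b, _, hb⟩
    simp at ha hb
    omega

noncomputable def F1 (n D : ℕ) : ℕ := {w : ℕ | w = n ∧ D ≤ w}.ncard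
noncomputable def F2 (n C D : ℕ) : ℕ :=
  {p : ℕ × ℕ | 2 * p.1 + p.2 = n ∧ C ≤ p.1 ∧ D ≤ p.1 + p.2}.ncard
noncomputable def F3 (n B C D : ℕ) : ℕ :=
  {p : ℕ × ℕ × ℕ | 3 * p.1 + 2 * p.2.1 + p.2.2 = n ∧ B ≤ p.1 ∧ C ≤ p.1 + p.2.1 ∧
    D ≤ p.1 + p.2.1 + p.2.2}.ncard
noncomputable def F4 (n A B C D : ℕ) : ℕ :=
  {p : ℕ × ℕ × ℕ × ℕ | 4 * p.1 + 3 * p.2.1 + 2 * p.2.2.1 + p.2.2.2 = n ∧ A ≤ p.1 ∧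
    B ≤ p.1 + p.2.1 ∧ C ≤ p.1 + p.2.1 + p.2.2.1 ∧
    D ≤ p.1 + p.2.1 + p.2.2.1 + p.2.2.2}.ncard
noncomputable def F11 (n C D : ℕ) : ℕ :=
  {p : ℕ × ℕ | p.1 + p.2 = n ∧ C ≤ p.1 ∧ D ≤ p.2}.ncard
/-- `2x+y+z=n`, `x ≥ B`, `x+y ≥ C`, `z ≥ D` -/
noncomputable def F211 (n B C D : ℕ) : ℕ :=
  {p : ℕ × ℕ × ℕ | 2 * p.1 + p.2.1 + p.2.2 = n ∧ B ≤ p.1 ∧ C ≤ p.1 + p.2.1 ∧ D ≤ p.2.2}.ncard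
/-- `3x+2y+z+w=n` -/
noncomputable def F31 (n A B C D : ℕ) : ℕ :=
  {p : ℕ × ℕ × ℕ × ℕ | 3 * p.1 + 2 * p.2.1 + p.2.2.1 + p.2.2.2 = n ∧ A ≤ p.1 ∧
    B ≤ p.1 + p.2.1 ∧ C ≤ p.1 + p.2.1 + p.2.2.1 ∧ D ≤ p.2.2.2}.ncard
/-- `2x+2y+z+w=n`, `x ≥ A`, `x+w ≥ B`, `y ≥ C`, `y+z ≥ D` -/
noncomputable def F22 (n A B C D : ℕ) : ℕ :=
  {p : ℕ × ℕ × ℕ × ℕ | 2 * p.1 + 2 * p.2.1 + p.2.2.1 + p.2.2.2 = n ∧ A ≤ p.1 ∧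
    B ≤ p.1 + p.2.2.2 ∧ C ≤ p.2.1 ∧ D ≤ p.2.1 + p.2.2.1}.ncard

lemma F1_eq (n D : ℕ) : F1 n D = if D ≤ n then 1 else 0 := by
  unfold F1
  split_ifs with h
  · rw [Set.ncard_eq_one]; refine ⟨n, ?_⟩; ext w; simp; omega
  · convert Set.ncard_empty ℕ; ext w; simp; omega

lemma F11_eq (n C D : ℕ) : F11 n C D = n + 1 - (C + D) := by
  unfold F11
  have : {p : ℕ × ℕ | p.1 + p.2 = n ∧ C ≤ p.1 ∧ D ≤ p.2} =
      (fun x : ℕ => (x, n - x)) '' (Finset.Ico C (n + 1 - D) : Finset ℕ) := by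
    ext ⟨x, y⟩
    simp
    omega
  rw [this, Set.ncard_image_of_injective _ (by intro a b h; simp at h; exact h.1),
    Set.ncard_coe_finset]
  simp
  omega

lemma fin2 (n : ℕ) (S : Set (ℕ × ℕ)) (h : ∀ p ∈ S, p.1 ≤ n ∧ p.2 ≤ n) : S.Finite :=
  (Set.finite_Iic (n, n)).subset fun p hp => ⟨(h p hp).1, (h p hp).2⟩
lemma fin3 (n : ℕ) (S : Set (ℕ × ℕ × ℕ)) (h : ∀ p ∈ S, p.1 ≤ n ∧ p.2.1 ≤ n ∧ p.2.2 ≤ n) :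
    S.Finite :=
  (Set.finite_Iic (n, n, n)).subset fun p hp => ⟨(h p hp).1, (h p hp).2⟩
lemma fin4 (n : ℕ) (S : Set (ℕ × ℕ × ℕ × ℕ))
    (h : ∀ p ∈ S, p.1 ≤ n ∧ p.2.1 ≤ n ∧ p.2.2.1 ≤ n ∧ p.2.2.2 ≤ n) : S.Finite :=
  (Set.finite_Iic (n, n, n, n)).subset fun p hp => ⟨(h p hp).1, (h p hp).2⟩

lemma F2_zero (n C : ℕ) : F2 (n + 2) 0 C = F1 (n + 2) C + F2 n 0 (C - 1) := by
  unfold F2 F1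
  rw [ncard_split _ (fin2 (n + 2) _ (by rintro ⟨x, y⟩ h; simp at h ⊢; omega))]
  congr 2 <;> ext p <;> simp only [Set.mem_ofPred_eq] <;> omega
lemma F2_succ (n C D : ℕ) : F2 (n + 2) (C + 1) D = F2 n C (D - 1) := by
  unfold F2
  rw [ncard_split _ (fin2 (n + 2) _ (by rintro ⟨x, y⟩ h; simp at h ⊢; omega))]
  simp
  congr 1; ext p; simp only [Set.mem_ofPred_eq]; omega
lemma F2_base (n D : ℕ) (h : n < 2) : F2 n 0 D = F1 n D := by
  unfold F2 F1
  rw [ncard_split _ (fin2 (n + 2) _ (by rintro ⟨x, y⟩ h; simp at h ⊢; omega))]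
  rw [show {p : ℕ × ℕ | (p.1 + 1, p.2) ∈ {p : ℕ × ℕ | 2 * p.1 + p.2 = n ∧ 0 ≤ p.1 ∧ D ≤ p.1 + p.2}} = ∅ by
    ext p; simp; omega]
  simp

lemma F3_zero (n C D : ℕ) : F3 (n + 3) 0 C D = F2 (n + 3) C D + F3 n 0 (C - 1) (D - 1) := by
  unfold F3 F2
  rw [ncard_split _ (fin3 (n + 3) _ (by rintro ⟨x, y, z⟩ h; simp at h ⊢; omega))]
  congr 2 <;> ext p <;> simp only [Set.mem_ofPred_eq] <;> omega
lemma F3_succ (n B C D : ℕ) : F3 (n + 3) (B + 1) C D = F3 n B (C - 1) (D - 1) := by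
  unfold F3
  rw [ncard_split _ (fin3 (n + 3) _ (by rintro ⟨x, y, z⟩ h; simp at h ⊢; omega))]
  simp
  congr 1; ext p; simp only [Set.mem_ofPred_eq]; omega
lemma F3_base (n C D : ℕ) (h : n < 3) : F3 n 0 C D = F2 n C D := by
  unfold F3 F2
  rw [ncard_split _ (fin3 (n + 3) _ (by rintro ⟨x, y, z⟩ h; simp at h ⊢; omega))]
  rw [Set.ncard_eq_zero (fin3 (n + 3) _ (by rintro ⟨x, y, z⟩ h; simp at h ⊢; omega)) |>.2 (by
    ext p; simp; omega)]
  simp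

lemma F4_zero (n B C D : ℕ) : F4 (n + 4) 0 B C D =
    F3 (n + 4) B C D + F4 n 0 (B - 1) (C - 1) (D - 1) := by
  unfold F4 F3
  rw [ncard_split _ (fin4 (n + 4) _ (by rintro ⟨x, y, z, w⟩ h; simp at h ⊢; omega))]
  congr 2 <;> ext p <;> simp only [Set.mem_ofPred_eq] <;> omega
lemma F4_succ (n A B C D : ℕ) : F4 (n + 4) (A + 1) B C D = F4 n A (B - 1) (C - 1) (D - 1) := by
  unfold F4
  rw [ncard_split _ (fin4 (n + 4) _ (by rintro ⟨x, y, z, w⟩ h; simp at h ⊢; omega))]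
  simp
  congr 1; ext p; simp only [Set.mem_ofPred_eq]; omega
lemma F4_base (n B C D : ℕ) (h : n < 4) : F4 n 0 B C D = F3 n B C D := by
  unfold F4 F3
  rw [ncard_split _ (fin4 (n + 4) _ (by rintro ⟨x, y, z, w⟩ h; simp at h ⊢; omega))]
  rw [Set.ncard_eq_zero (fin4 (n + 4) _ (by rintro ⟨x, y, z, w⟩ h; simp at h ⊢; omega)) |>.2 (by
    ext p; simp; omega)]
  simp
lemma F4_one (n : ℕ) : F4 (n + 1) 0 0 0 1 = F4 (n + 1) 0 0 0 0 := by
  unfold F4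
  congr 1; ext p; simp; omega

lemma F211_zero (n C D : ℕ) : F211 (n + 2) 0 C D = F11 (n + 2) C D + F211 n 0 (C - 1) D := by
  unfold F211 F11
  rw [ncard_split _ (fin3 (n + 3) _ (by rintro ⟨x, y, z⟩ h; simp at h ⊢; omega))]
  congr 2 <;> ext p <;> simp only [Set.mem_ofPred_eq] <;> omega
lemma F211_succ (n B C D : ℕ) : F211 (n + 2) (B + 1) C D = F211 n B (C - 1) D := by
  unfold F211
  rw [ncard_split _ (fin3 (n + 3) _ (by rintro ⟨x, y, z⟩ h; simp at h ⊢; omega))]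
  simp
  congr 1; ext p; simp only [Set.mem_ofPred_eq]; omega
lemma F211_base (n C D : ℕ) (h : n < 2) : F211 n 0 C D = F11 n C D := by
  unfold F211 F11
  rw [ncard_split _ (fin3 (n + 3) _ (by rintro ⟨x, y, z⟩ h; simp at h ⊢; omega))]
  rw [Set.ncard_eq_zero (fin3 (n + 3) _ (by rintro ⟨x, y, z⟩ h; simp at h ⊢; omega)) |>.2 (by
    ext p; simp; omega)]
  simp
lemma F211_w (n B C D : ℕ) : F211 (n + 1) B C (D + 1) = F211 n B C D := by
  unfold F211
  refine Eq.trans ?_ (Set.ncard_image_of_injective (f := fun p : ℕ × ℕ × ℕ => (p.1, p.2.1, p.2.2 + 1)) _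
    (by rintro ⟨a, b, c⟩ ⟨x, y, z⟩ h; simpa using h))
  congr 1
  ext ⟨x, y, z⟩
  cases z <;> simp; omega

lemma F31_zero (n B C D : ℕ) : F31 (n + 3) 0 B C D =
    F211 (n + 3) B C D + F31 n 0 (B - 1) (C - 1) D := by
  unfold F31 F211
  rw [ncard_split _ (fin4 (n + 4) _ (by rintro ⟨x, y, z, w⟩ h; simp at h ⊢; omega))]
  congr 2 <;> ext p <;> simp only [Set.mem_ofPred_eq] <;> omega
lemma F31_succ (n A B C D : ℕ) : F31 (n + 3) (A + 1) B C D = F31 n A (B - 1) (C - 1) D := by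
  unfold F31
  rw [ncard_split _ (fin4 (n + 4) _ (by rintro ⟨x, y, z, w⟩ h; simp at h ⊢; omega))]
  simp
  congr 1; ext p; simp only [Set.mem_ofPred_eq]; omega
lemma F31_base (n B C D : ℕ) (h : n < 3) : F31 n 0 B C D = F211 n B C D := by
  unfold F31 F211
  rw [ncard_split _ (fin4 (n + 4) _ (by rintro ⟨x, y, z, w⟩ h; simp at h ⊢; omega))]
  rw [Set.ncard_eq_zero (fin4 (n + 4) _ (by rintro ⟨x, y, z, w⟩ h; simp at h ⊢; omega)) |>.2 (by
    ext p; simp; omega)]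
  simp
lemma F31_w (n A B C D : ℕ) : F31 (n + 1) A B C (D + 1) = F31 n A B C D := by
  unfold F31
  refine Eq.trans ?_ (Set.ncard_image_of_injective
    (f := fun p : ℕ × ℕ × ℕ × ℕ => (p.1, p.2.1, p.2.2.1, p.2.2.2 + 1)) _
    (by rintro ⟨a, b, c, d⟩ ⟨x, y, z, w⟩ h; simpa using h))
  congr 1
  ext ⟨x, y, z, w⟩
  cases w <;> simp; omega

lemma F22_zero (n B C D : ℕ) : F22 (n + 2) 0 B C D =
    F211 (n + 2) C D B + F22 n 0 (B - 1) C D := by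
  unfold F22 F211
  rw [ncard_split _ (fin4 (n + 4) _ (by rintro ⟨x, y, z, w⟩ h; simp at h ⊢; omega))]
  congr 2 <;> ext p <;> simp only [Set.mem_ofPred_eq] <;> omega
lemma F22_succ (n A B C D : ℕ) : F22 (n + 2) (A + 1) B C D = F22 n A (B - 1) C D := by
  unfold F22
  rw [ncard_split _ (fin4 (n + 4) _ (by rintro ⟨x, y, z, w⟩ h; simp at h ⊢; omega))]
  simp
  congr 1; ext p; simp only [Set.mem_ofPred_eq]; omega
lemma F22_base (n B C D : ℕ) (h : n < 2) : F22 n 0 B C D = F211 n C D B := by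
  unfold F22 F211
  rw [ncard_split _ (fin4 (n + 4) _ (by rintro ⟨x, y, z, w⟩ h; simp at h ⊢; omega))]
  rw [Set.ncard_eq_zero (fin4 (n + 4) _ (by rintro ⟨x, y, z, w⟩ h; simp at h ⊢; omega)) |>.2 (by
    ext p; simp; omega)]
  rw [add_zero]
  congr 1; ext p; simp only [Set.mem_ofPred_eq]; omega
lemma F22_swap (n A B C D : ℕ) : F22 n A B C D = F22 n C D A B := by
  unfold F22
  rw [← Set.ncard_image_of_injective
    (f := fun p : ℕ × ℕ × ℕ × ℕ => (p.2.1, p.1, p.2.2.2, p.2.2.1)) _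
    (by rintro ⟨a, b, c, d⟩ ⟨x, y, z, w⟩ h; simp at h ⊢; omega)]
  congr 1
  ext ⟨x, y, z, w⟩
  simp
  omega
def g2 : ℕ → ℤ | 0 => 4 | _ => 2
def g3 : ℕ → ℤ | 0 => 12 | 1 => 5 | 2 => 8 | 3 => 9 | 4 => 8 | _ => 5
def l4 : ℕ → ℤ | 0 => 72 | _ => 63
def g4 : ℕ → ℤ
  | 0 => 144 | 1 => 65 | 2 => 76 | 3 => 81 | 4 => 128 | 5 => 49 | 6 => 108 | 7 => 65 | 8 => 112
  | 9 => 81 | 10 => 92 | _ => 49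
def g211 : ℕ → ℤ | 0 => 4 | _ => 3
def l22 : ℕ → ℤ | 0 => 52 | _ => 46
def g22 : ℕ → ℤ | 0 => 48 | _ => 30
def g31 : ℕ → ℤ | 0 => 72 | 1 => 55 | 2 => 56 | 3 => 63 | 4 => 64 | _ => 47

lemma mod2 (q i : ℕ) : (12 * q + i) % 2 = i % 2 := by omega
lemma mod6 (q i : ℕ) : (12 * q + i) % 6 = i % 6 := by omega
lemma mod12 (q i : ℕ) : (12 * q + i) % 12 = i % 12 := by omega
lemma div12 (k : ℕ) : ∃ q r, r < 12 ∧ k = 12 * q + r :=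
  ⟨k / 12, k % 12, Nat.mod_lt _ (by norm_num), by omega⟩

lemma cf2 (n : ℕ) : 4 * (F2 n 0 0 : ℤ) = 2 * n + g2 (n % 2) := by
  induction n using Nat.strong_induction_on with
  | _ n ih =>
    rcases Nat.lt_or_ge n 2 with h | h
    · rw [F2_base _ _ h]
      interval_cases n <;> simp [F1_eq, g2]
    · obtain ⟨k, rfl⟩ := Nat.exists_eq_add_of_le' h
      have := ih k (by omega)
      rw [F2_zero, F1_eq]
      simp at this ⊢
      linarith
lemma cf3 (n : ℕ) : 12 * (F3 n 0 0 0 : ℤ) = n ^ 2 + 6 * n + g3 (n % 6) := by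
  induction n using Nat.strong_induction_on with
  | _ n ih =>
    rcases Nat.lt_or_ge n 3 with h | h
    · rw [F3_base _ _ _ h]
      have := cf2 n
      interval_cases n <;> simp [g2, g3] at this ⊢ <;> omega
    · obtain ⟨k, rfl⟩ := Nat.exists_eq_add_of_le' h
      have h1 := ih k (by omega)
      have h2 := cf2 (k + 3)
      rw [F3_zero]
      obtain ⟨q, r, hr, rfl⟩ := div12 k
      interval_cases r <;> simp only [mod2, mod6, mod12, Nat.add_assoc, Nat.reduceAdd, Nat.reduceMod, g2, g3, zero_tsub] at h1 h2 ⊢ <;>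
        push_cast at h1 h2 ⊢ <;> linarith
lemma cf4 (n : ℕ) : 144 * (F4 n 0 0 0 0 : ℤ) = n ^ 3 + 15 * n ^ 2 + l4 (n % 2) * n + g4 (n % 12) := by
  induction n using Nat.strong_induction_on with
  | _ n ih =>
    rcases Nat.lt_or_ge n 4 with h | h
    · rw [F4_base _ _ _ _ h]
      have := cf3 n
      interval_cases n <;> simp [g3, g4, l4] at this ⊢ <;> omega
    · obtain ⟨k, rfl⟩ := Nat.exists_eq_add_of_le' h
      have h1 := ih k (by omega)
      have h2 := cf3 (k + 4)
      rw [F4_zero]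
      obtain ⟨q, r, hr, rfl⟩ := div12 k
      interval_cases r <;> simp only [mod2, mod6, mod12, Nat.add_assoc, Nat.reduceAdd, Nat.reduceMod, g4, l4, g3, zero_tsub] at h1 h2 ⊢ <;>
        push_cast at h1 h2 ⊢ <;> linarith
lemma cf211 (n : ℕ) : 4 * (F211 n 0 0 0 : ℤ) = n ^ 2 + 4 * n + g211 (n % 2) := by
  induction n using Nat.strong_induction_on with
  | _ n ih =>
    rcases Nat.lt_or_ge n 2 with h | h
    · rw [F211_base _ _ _ h]
      interval_cases n <;> simp [F11_eq, g211]
    · obtain ⟨k, rfl⟩ := Nat.exists_eq_add_of_le' h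
      have := ih k (by omega)
      rw [F211_zero, F11_eq]
      simp at this ⊢
      linarith
lemma cf22 (n : ℕ) : 48 * (F22 n 0 0 0 0 : ℤ) = 2 * n ^ 3 + 18 * n ^ 2 + l22 (n % 2) * n + g22 (n % 2) := by
  induction n using Nat.strong_induction_on with
  | _ n ih =>
    rcases Nat.lt_or_ge n 2 with h | h
    · rw [F22_base _ _ _ _ h]
      have := cf211 n
      interval_cases n <;> simp [g211, g22, l22] at this ⊢ <;> omega
    · obtain ⟨k, rfl⟩ := Nat.exists_eq_add_of_le' h
      have h1 := ih k (by omega)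
      have h2 := cf211 (k + 2)
      rw [F22_zero]
      obtain ⟨q, r, hr, rfl⟩ := div12 k
      interval_cases r <;> simp only [mod2, mod6, mod12, Nat.add_assoc, Nat.reduceAdd, Nat.reduceMod, g22, l22, g211, zero_tsub] at h1 h2 ⊢ <;>
        push_cast at h1 h2 ⊢ <;> linarith
lemma cf31 (n : ℕ) : 72 * (F31 n 0 0 0 0 : ℤ) = 2 * n ^ 3 + 21 * n ^ 2 + 66 * n + g31 (n % 6) := by
  induction n using Nat.strong_induction_on with
  | _ n ih =>
    rcases Nat.lt_or_ge n 3 with h | h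
    · rw [F31_base _ _ _ _ h]
      have := cf211 n
      interval_cases n <;> simp [g211, g31] at this ⊢ <;> omega
    · obtain ⟨k, rfl⟩ := Nat.exists_eq_add_of_le' h
      have h1 := ih k (by omega)
      have h2 := cf211 (k + 3)
      rw [F31_zero]
      obtain ⟨q, r, hr, rfl⟩ := div12 k
      interval_cases r <;> simp only [mod2, mod6, mod12, Nat.add_assoc, Nat.reduceAdd, Nat.reduceMod, g31, g211, zero_tsub] at h1 h2 ⊢ <;>
        push_cast at h1 h2 ⊢ <;> linarith


lemma F4_z (n B C D : ℕ) : F4 (n + 4) 0 B C (D + 1) =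
    F3 (n + 4) B C (D + 1) + F4 n 0 (B - 1) (C - 1) D := by rw [F4_zero]; rfl
lemma F3_z (n C D : ℕ) : F3 (n + 3) 0 C (D + 1) = F2 (n + 3) C (D + 1) + F3 n 0 (C - 1) D := by
  rw [F3_zero]; rfl
lemma F2_z (n D : ℕ) : F2 (n + 2) 0 (D + 1) = F1 (n + 2) (D + 1) + F2 n 0 D := by
  rw [F2_zero]; rfl
lemma F211_z (n C D : ℕ) : F211 (n + 2) 0 (C + 1) D = F11 (n + 2) (C + 1) D + F211 n 0 C D := by
  rw [F211_zero]; rfl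
lemma F31_z (n B C D : ℕ) : F31 (n + 3) 0 B (C + 1) D =
    F211 (n + 3) B (C + 1) D + F31 n 0 (B - 1) C D := by rw [F31_zero]; rfl
lemma F22_z (n B C D : ℕ) : F22 (n + 2) 0 (B + 1) C D =
    F211 (n + 2) C D (B + 1) + F22 n 0 B C D := by rw [F22_zero]; rfl
lemma F22_s (n C D : ℕ) : F22 n 0 0 (C + 1) D = F22 n (C + 1) D 0 0 := F22_swap _ _ _ _ _
lemma F3_one (n : ℕ) : F3 (n + 1) 0 0 1 = F3 (n + 1) 0 0 0 := by
  unfold F3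
  congr 1; ext p; simp; omega
lemma total_red (k : ℕ) : F4 (k + 17) 1 2 3 4 + F31 (k + 17) 1 2 3 5 + F22 (k + 17) 1 2 4 5 +
    F31 (k + 17) 3 4 5 1 + F4 (k + 17) 2 3 4 5 =
    1 + F2 (k + 6) 0 0 + (1 + F2 (k + 5) 0 0 + F3 (k + 4) 0 0 0) +
              (1 + F2 (k + 5) 0 0 + (1 + F2 (k + 4) 0 0 + F3 (k + 3) 0 0 0) +
                (1 + F2 (k + 3) 0 0 + F3 (k + 2) 0 0 0 + F4 (k + 1) 0 0 0 0)) +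
            (k + 5 + 2 + F211 (k + 5) 0 0 0 + (k + 4 + 2 + F211 (k + 4) 0 0 0 + F31 (k + 3) 0 0 0 0)) +
          (k + 4 + 2 + F211 (k + 4) 0 0 0 + (F211 (k + 4) 0 0 0 + F22 (k + 3) 0 0 0 0)) +
        (k + 3 + 2 + F211 (k + 3) 0 0 0 + (k + 2 + 2 + F211 (k + 2) 0 0 0 + F31 (k + 1) 0 0 0 0)) +
      (1 + F2 (k + 2) 0 0 + (1 + F2 (k + 1) 0 0 + F3 k 0 0 0) +
        (1 + F2 (k + 1) 0 0 + F3 (k + 2) 0 0 0 + F4 (k + 1) 0 0 0 0)) := by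
  simp [F4_z, F4_succ, F4_one, F3_one, F3_z, F3_succ, F2_z, F2_succ, F1_eq, F31_w, F31_z, F31_succ,
    F211_w, F211_z, F211_succ, F22_z, F22_s, F22_succ, F11_eq]

set_option maxHeartbeats 8000000 in
lemma total_formula (n m a : ℕ) (hn : 16 < n) (ha : a ≤ 11) (hma : n = 12 * m + a) (R : ℕ)
    (hR : R = F4 n 1 2 3 4 + F31 n 1 2 3 5 + F22 n 1 2 4 5 + F31 n 3 4 5 1 + F4 n 2 3 4 5) :
    (a = 0 → (R : ℤ) = 192 * m ^ 3 - 264 * m ^ 2 + 87 * m - 3) ∧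
    (a = 1 → (R : ℤ) = 192 * m ^ 3 - 216 * m ^ 2 + 44 * m + 5) ∧
    (a = 2 → (R : ℤ) = 192 * m ^ 3 - 168 * m ^ 2 + 15 * m + 5) ∧
    (a = 3 → (R : ℤ) = 192 * m ^ 3 - 120 * m ^ 2 - 12 * m + 7) ∧
    (a = 4 → (R : ℤ) = 192 * m ^ 3 - 72 * m ^ 2 - 25 * m + 4) ∧
    (a = 5 → (R : ℤ) = 192 * m ^ 3 - 24 * m ^ 2 - 36 * m + 3) ∧
    (a = 6 → (R : ℤ) = 192 * m ^ 3 + 24 * m ^ 2 - 33 * m - 2) ∧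
    (a = 7 → (R : ℤ) = 192 * m ^ 3 + 72 * m ^ 2 - 28 * m - 3) ∧
    (a = 8 → (R : ℤ) = 192 * m ^ 3 + 120 * m ^ 2 - 9 * m - 5) ∧
    (a = 9 → (R : ℤ) = 192 * m ^ 3 + 168 * m ^ 2 + 12 * m - 5) ∧
    (a = 10 → (R : ℤ) = 192 * m ^ 3 + 216 * m ^ 2 + 47 * m - 3) ∧
    (a = 11 → (R : ℤ) = 192 * m ^ 3 + 264 * m ^ 2 + 84 * m + 3) := by
  obtain ⟨k, rfl⟩ := Nat.exists_eq_add_of_le' (show 17 ≤ n by omega)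
  rw [total_red] at hR
  have hk : (k : ℤ) = 12 * m + a - 17 := by omega
  have e := congrArg (fun x : ℕ => (x : ℤ)) hR
  simp only [Nat.cast_add, Nat.cast_one, Nat.cast_ofNat] at e
  have a1 := cf2 (k + 6)
  have a2 := cf2 (k + 5)
  have a3 := cf2 (k + 4)
  have a4 := cf2 (k + 3)
  have a5 := cf2 (k + 2)
  have a6 := cf2 (k + 1)
  have b1 := cf3 (k + 4)
  have b2 := cf3 (k + 3)
  have b3 := cf3 (k + 2)
  have b4 := cf3 k
  have c1 := cf4 (k + 1)
  have d1 := cf211 (k + 5)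
  have d2 := cf211 (k + 4)
  have d3 := cf211 (k + 3)
  have d4 := cf211 (k + 2)
  have e1 := cf31 (k + 3)
  have e2 := cf31 (k + 1)
  have f1 := cf22 (k + 3)
  clear hR hn
  obtain ⟨q, r, hr, rfl⟩ := div12 k
  have hcase : (r < 7 ∧ m = q + 1 ∧ a = r + 5) ∨ (7 ≤ r ∧ m = q + 2 ∧ a = r - 7) := by
    clear a1 a2 a3 a4 a5 a6 b1 b2 b3 b4 c1 d1 d2 d3 d4 e1 e2 f1 e hk
    omega
  clear hk hma ha
  rcases hcase with ⟨hr1, rfl, rfl⟩ | ⟨hr1, rfl, rfl⟩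
  all_goals
    interval_cases r <;>
    simp only [mod2, mod6, mod12, Nat.add_assoc, Nat.reduceAdd, Nat.reduceMod, g2, g3, g4, l4,
      g211, g22, l22, g31] at a1 a2 a3 a4 a5 a6 b1 b2 b3 b4 c1 d1 d2 d3 d4 e1 e2 f1 <;>
    simp only [Nat.add_assoc, Nat.reduceAdd] at e <;>
    push_cast at * <;>
    norm_num only [true_and, and_true, false_imp_iff, forall_const] <;>
    linarith

lemma durfee_four {n : ℕ} (hn : 16 < n) (p : n.Partition) : durfee p = 4 ↔
    (5 ≤ part p 1 + 1 ∧ 5 ≤ part p 2 + 2 ∧ 5 ≤ part p 3 + 3 ∧ 5 ≤ part p 4 + 4) ∧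
    ¬ (6 ≤ part p 1 + 1 ∧ 6 ≤ part p 2 + 2 ∧ 6 ≤ part p 3 + 3 ∧ 6 ≤ part p 4 + 4 ∧
      6 ≤ part p 5 + 5) := by
  unfold durfee
  refine (@Nat.findGreatest_eq_iff _ _ _ (fun _ => Classical.propDecidable _)).trans ?_
  constructor
  · rintro ⟨-, h1, h2⟩
    have h1 := h1 (by norm_num)
    have h2 := h2 (show 4 < 5 by norm_num) (by omega)
    refine ⟨⟨h1 1 (by simp), h1 2 (by simp), h1 3 (by simp), h1 4 (by simp)⟩, ?_⟩
    rintro ⟨a, b, c, d, e⟩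
    apply h2
    intro i hi
    rw [Finset.mem_Icc] at hi
    obtain ⟨hi1, hi2⟩ := hi
    interval_cases i <;> assumption
  · rintro ⟨⟨a, b, c, d⟩, h⟩
    refine ⟨by omega, fun _ => ?_, ?_⟩
    · intro i hi
      rw [Finset.mem_Icc] at hi
      obtain ⟨hi1, hi2⟩ := hi
      interval_cases i <;> assumption
    · intro k hk _ hh
      apply h
      have h1 := hh 1 (by simp; omega)
      have h2 := hh 2 (by simp; omega)
      have h3 := hh 3 (by simp; omega)
      have h4 := hh 4 (by simp; omega)
      have h5 := hh 5 (by simp; omega)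
      omega

def LS (n : ℕ) : Set (List ℕ) := {l | l.Pairwise (· ≥ ·) ∧ (∀ x ∈ l, 0 < x) ∧ l.sum = n}

lemma R_list {n : ℕ} (hn : 16 < n) : R 4 n = {l ∈ LS n |
    (5 ≤ l.getD 0 0 + 1 ∧ 5 ≤ l.getD 1 0 + 2 ∧ 5 ≤ l.getD 2 0 + 3 ∧ 5 ≤ l.getD 3 0 + 4) ∧
    ¬ (6 ≤ l.getD 0 0 + 1 ∧ 6 ≤ l.getD 1 0 + 2 ∧ 6 ≤ l.getD 2 0 + 3 ∧ 6 ≤ l.getD 3 0 + 4 ∧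
      6 ≤ l.getD 4 0 + 5)}.ncard := by
  unfold R
  rw [← Set.ncard_coe_finset]
  rw [← Set.ncard_image_of_injective (f := fun p : n.Partition => p.parts.sort (· ≥ ·))]
  · congr 1
    ext l
    simp only [Set.mem_image, Finset.coe_filter, Finset.mem_univ, true_and, Set.mem_ofPred_eq,
      durfee_four hn, part]
    constructor
    · rintro ⟨p, hp, rfl⟩
      refine ⟨⟨Multiset.pairwise_sort _ _, ?_, ?_⟩, hp⟩
      · intro x hx
        exact p.parts_pos (by simpa using hx)
      · rw [← Multiset.sum_coe, Multiset.sort_eq, p.parts_sum]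
    · rintro ⟨⟨h1, h2, h3⟩, h⟩
      have hs : (l : Multiset ℕ).sort (· ≥ ·) = l := by
        refine List.Perm.eq_of_pairwise' (r := (· ≥ ·)) (Multiset.pairwise_sort _ _) h1 ?_
        rw [← Multiset.coe_eq_coe, Multiset.sort_eq]
      refine ⟨⟨(l : Multiset ℕ), fun {i} hi => h2 i (by simpa using hi), by simpa using h3⟩, ?_, hs⟩
      simpa only [hs] using h
  · intro p q h
    have := congrArg (fun l : List ℕ => (l : Multiset ℕ)) h
    simp only [Multiset.sort_eq] at this
    exact Nat.Partition.ext this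

lemma getD_rep (a v : ℕ) (l : List ℕ) (i : ℕ) :
    (List.replicate a v ++ l).getD i 0 = if i < a then v else l.getD (i - a) 0 := by
  simp only [List.getD_eq_getElem?_getD, List.getElem?_append, List.getElem?_replicate,
    List.length_replicate]
  split_ifs <;> simp
lemma getD_rep' (a v : ℕ) (i : ℕ) :
    (List.replicate a v).getD i 0 = if i < a then v else 0 := by
  simp only [List.getD_eq_getElem?_getD, List.getElem?_replicate]
  split_ifs <;> simp

lemma decomp (k : ℕ) (l : List ℕ) (h : l.Pairwise (· ≥ ·)) (hk : ∀ x ∈ l, x ≤ k + 1) :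
    ∃ a l', l = List.replicate a (k + 1) ++ l' ∧ l'.Pairwise (· ≥ ·) ∧ ∀ x ∈ l', x ≤ k := by
  induction l with
  | nil => exact ⟨0, [], by simp⟩
  | cons x t ih =>
    rw [List.pairwise_cons] at h
    by_cases hx : x = k + 1
    · obtain ⟨a, l', h1, h2, h3⟩ := ih h.2 (fun y hy => hk y (by simp [hy]))
      exact ⟨a + 1, l', by simp [List.replicate_succ, h1, hx], h2, h3⟩
    · have := hk x (by simp)
      refine ⟨0, x :: t, by simp, List.pairwise_cons.2 h, ?_⟩
      intro y hy
      rcases List.mem_cons.1 hy with rfl | hy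
      · omega
      · have := h.1 y hy
        omega

lemma decomp1 (l : List ℕ) (hp : ∀ x ∈ l, 0 < x) (hk : ∀ x ∈ l, x ≤ 1) :
    ∃ a, l = List.replicate a 1 := by
  refine ⟨l.length, List.eq_replicate_of_mem fun b hb => ?_⟩
  have := hp b hb
  have := hk b hb
  omega
lemma decomp2 (l : List ℕ) (h : l.Pairwise (· ≥ ·)) (hp : ∀ x ∈ l, 0 < x) (hk : ∀ x ∈ l, x ≤ 2) :
    ∃ a b, l = List.replicate a 2 ++ List.replicate b 1 := by
  obtain ⟨a, l', rfl, h1, h2⟩ := decomp 1 l h hk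
  obtain ⟨b, rfl⟩ := decomp1 l' (fun x hx => hp x (by simp [hx])) h2
  exact ⟨a, b, rfl⟩
lemma decomp3 (l : List ℕ) (h : l.Pairwise (· ≥ ·)) (hp : ∀ x ∈ l, 0 < x) (hk : ∀ x ∈ l, x ≤ 3) :
    ∃ a b c, l = List.replicate a 3 ++ (List.replicate b 2 ++ List.replicate c 1) := by
  obtain ⟨a, l', rfl, h1, h2⟩ := decomp 2 l h hk
  obtain ⟨b, c, rfl⟩ := decomp2 l' h1 (fun x hx => hp x (by simp [hx])) h2
  exact ⟨a, b, c, rfl⟩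
lemma decomp4 (l : List ℕ) (h : l.Pairwise (· ≥ ·)) (hp : ∀ x ∈ l, 0 < x) (hk : ∀ x ∈ l, x ≤ 4) :
    ∃ a b c d, l = List.replicate a 4 ++ (List.replicate b 3 ++
      (List.replicate c 2 ++ List.replicate d 1)) := by
  obtain ⟨a, l', rfl, h1, h2⟩ := decomp 3 l h hk
  obtain ⟨b, c, d, rfl⟩ := decomp3 l' h1 (fun x hx => hp x (by simp [hx])) h2
  exact ⟨a, b, c, d, rfl⟩

lemma head_bound (l : List ℕ) (h : l.Pairwise (· ≥ ·)) : ∀ x ∈ l, x ≤ l.getD 0 0 := by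
  cases l with
  | nil => simp
  | cons y t =>
    rw [List.pairwise_cons] at h
    intro x hx
    rcases List.mem_cons.1 hx with rfl | hx
    · simp
    · simpa using h.1 x hx

def C1 (u : ℕ → ℕ) : Prop := u 0 = 4 ∧ 3 ≤ u 1 ∧ 2 ≤ u 2 ∧ 1 ≤ u 3
def C2 (u : ℕ → ℕ) : Prop := 5 ≤ u 0 ∧ u 1 = 3 ∧ 2 ≤ u 2 ∧ 1 ≤ u 3
def C3 (u : ℕ → ℕ) : Prop := 5 ≤ u 0 ∧ 4 ≤ u 1 ∧ u 2 = 2 ∧ 1 ≤ u 3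
def C4 (u : ℕ → ℕ) : Prop := 5 ≤ u 0 ∧ 4 ≤ u 1 ∧ 3 ≤ u 2 ∧ u 3 = 1
def C5 (u : ℕ → ℕ) : Prop := 5 ≤ u 0 ∧ 4 ≤ u 1 ∧ 3 ≤ u 2 ∧ 2 ≤ u 3 ∧ u 4 = 0

def U (l : List ℕ) (i : ℕ) : ℕ := l.getD i 0

lemma case1 (n : ℕ) : {l ∈ LS n | C1 (U l)}.ncard = F4 n 1 2 3 4 := by
  unfold F4
  rw [← Set.ncard_image_of_injective (f := fun p : ℕ × ℕ × ℕ × ℕ =>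
    List.replicate p.1 4 ++ (List.replicate p.2.1 3 ++
      (List.replicate p.2.2.1 2 ++ List.replicate p.2.2.2 1)))]
  · congr 1
    ext l
    constructor
    · rintro ⟨⟨h1, h2, h3⟩, h⟩
      obtain ⟨a, b, c, d, rfl⟩ := decomp4 l h1 h2 (fun x hx => (head_bound l h1 x hx).trans h.1.le)
      refine ⟨(a, b, c, d), ?_, rfl⟩
      simp only [C1, U, getD_rep, getD_rep'] at h
      simp at h3 ⊢
      grind
    · rintro ⟨⟨a, b, c, d⟩, h, rfl⟩
      simp only [Set.mem_ofPred_eq] at h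
      refine ⟨⟨?_, ?_, ?_⟩, ?_⟩
      · simp only [List.pairwise_append, List.pairwise_replicate, List.mem_append, List.mem_replicate]
        grind
      · simp only [List.mem_append, List.mem_replicate]
        grind
      · simp; omega
      · simp only [C1, U, getD_rep, getD_rep']
        grind
  · rintro ⟨a, b, c, d⟩ ⟨a', b', c', d'⟩ h
    have e1 := congrArg (List.count 1) h
    have e2 := congrArg (List.count 2) h
    have e3 := congrArg (List.count 3) h
    have e4 := congrArg (List.count 4) h
    simp [List.count_replicate] at e1 e2 e3 e4
    simp [*]

lemma case2 (n : ℕ) : {l ∈ LS n | C2 (U l)}.ncard = F31 n 1 2 3 5 := by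
  unfold F31
  rw [← Set.ncard_image_of_injective (f := fun p : ℕ × ℕ × ℕ × ℕ =>
    p.2.2.2 :: (List.replicate p.1 3 ++
      (List.replicate p.2.1 2 ++ List.replicate p.2.2.1 1)))]
  · congr 1
    ext l
    constructor
    · rintro ⟨⟨h1, h2, h3⟩, h⟩
      rcases l with _ | ⟨x, l⟩
      · simp [C2, U] at h
      simp only [C2, U, List.getD_cons_zero, List.getD_cons_succ] at h
      rw [List.pairwise_cons] at h1
      obtain ⟨a, b, c, rfl⟩ := decomp3 l h1.2 (fun y hy => h2 y (by simp [hy]))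
        (fun x hx => (head_bound l h1.2 x hx).trans h.2.1.le)
      refine ⟨(a, b, c, x), ?_, rfl⟩
      simp only [getD_rep, getD_rep'] at h
      simp at h3 ⊢
      grind
    · rintro ⟨⟨a, b, c, x⟩, h, rfl⟩
      simp only [Set.mem_ofPred_eq] at h
      refine ⟨⟨?_, ?_, ?_⟩, ?_⟩
      · simp only [List.pairwise_cons, List.pairwise_append, List.pairwise_replicate, List.mem_append,
          List.mem_replicate]
        grind
      · simp only [List.mem_cons, List.mem_append, List.mem_replicate]
        grind
      · simp; omega
      · simp only [C2, U, List.getD_cons_zero, List.getD_cons_succ, getD_rep, getD_rep']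
        grind
  · rintro ⟨a, b, c, d⟩ ⟨a', b', c', d'⟩ h
    simp only [List.cons.injEq] at h
    obtain ⟨h0, h⟩ := h
    have e1 := congrArg (List.count 1) h
    have e2 := congrArg (List.count 2) h
    have e3 := congrArg (List.count 3) h
    simp [List.count_replicate] at e1 e2 e3
    simp [*]

lemma case3 (n : ℕ) : {l ∈ LS n | C3 (U l)}.ncard = F22 n 1 2 4 5 := by
  unfold F22
  rw [← Set.ncard_image_of_injective (f := fun p : ℕ × ℕ × ℕ × ℕ =>
    (p.2.1 + p.2.2.1) :: p.2.1 :: (List.replicate p.1 2 ++ List.replicate p.2.2.2 1))]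
  · congr 1
    ext l
    constructor
    · rintro ⟨⟨h1, h2, h3⟩, h⟩
      rcases l with _ | ⟨x, _ | ⟨y, l⟩⟩
      · simp [C3, U] at h
      · simp [C3, U] at h
      simp only [C3, U, List.getD_cons_zero, List.getD_cons_succ] at h
      rw [List.pairwise_cons, List.pairwise_cons] at h1
      have hxy := h1.1 y (by simp)
      obtain ⟨a, b, rfl⟩ := decomp2 l h1.2.2 (fun y hy => h2 y (by simp [hy]))
        (fun x hx => (head_bound l h1.2.2 x hx).trans h.2.2.1.le)
      refine ⟨(a, y, x - y, b), ?_, by simp; omega⟩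
      simp only [getD_rep, getD_rep'] at h
      simp at h3 ⊢
      grind
    · rintro ⟨⟨a, b, c, x⟩, h, rfl⟩
      simp only [Set.mem_ofPred_eq] at h
      refine ⟨⟨?_, ?_, ?_⟩, ?_⟩
      · simp only [List.pairwise_cons, List.pairwise_append, List.pairwise_replicate, List.mem_append,
          List.mem_replicate, List.mem_cons]
        grind
      · simp only [List.mem_cons, List.mem_append, List.mem_replicate]
        grind
      · simp; omega
      · simp only [C3, U, List.getD_cons_zero, List.getD_cons_succ, getD_rep, getD_rep']
        grind
  · rintro ⟨a, b, c, d⟩ ⟨a', b', c', d'⟩ h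
    simp only [List.cons.injEq] at h
    obtain ⟨h0, h1, h⟩ := h
    have e1 := congrArg (List.count 1) h
    have e2 := congrArg (List.count 2) h
    simp [List.count_replicate] at e1 e2
    simp; omega

lemma case4 (n : ℕ) : {l ∈ LS n | C4 (U l)}.ncard = F31 n 3 4 5 1 := by
  unfold F31
  rw [← Set.ncard_image_of_injective (f := fun p : ℕ × ℕ × ℕ × ℕ =>
    (p.1 + p.2.1 + p.2.2.1) :: (p.1 + p.2.1) :: p.1 :: List.replicate p.2.2.2 1)]
  · congr 1
    ext l
    constructor
    · rintro ⟨⟨h1, h2, h3⟩, h⟩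
      rcases l with _ | ⟨x, _ | ⟨y, _ | ⟨z, l⟩⟩⟩
      · simp [C4, U] at h
      · simp [C4, U] at h
      · simp [C4, U] at h
      simp only [C4, U, List.getD_cons_zero, List.getD_cons_succ] at h
      rw [List.pairwise_cons, List.pairwise_cons, List.pairwise_cons] at h1
      have hxy := h1.1 y (by simp)
      have hyz := h1.2.1 z (by simp)
      obtain ⟨a, rfl⟩ := decomp1 l (fun y hy => h2 y (by simp [hy]))
        (fun x hx => (head_bound l h1.2.2.2 x hx).trans h.2.2.2.le)
      refine ⟨(z, y - z, x - y, a), ?_, by simp; omega⟩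
      simp only [getD_rep'] at h
      simp at h3 ⊢
      grind
    · rintro ⟨⟨a, b, c, x⟩, h, rfl⟩
      simp only [Set.mem_ofPred_eq] at h
      refine ⟨⟨?_, ?_, ?_⟩, ?_⟩
      · simp only [List.pairwise_cons, List.pairwise_replicate, 
          List.mem_replicate, List.mem_cons]
        grind
      · simp only [List.mem_cons, List.mem_replicate]
        grind
      · simp; omega
      · simp only [C4, U, List.getD_cons_zero, List.getD_cons_succ, getD_rep']
        grind
  · rintro ⟨a, b, c, d⟩ ⟨a', b', c', d'⟩ h
    simp only [List.cons.injEq] at h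
    obtain ⟨h0, h1, h2, h⟩ := h
    have e1 := congrArg (List.count 1) h
    simp at e1
    simp; omega

lemma case5 (n : ℕ) : {l ∈ LS n | C5 (U l)}.ncard = F4 n 2 3 4 5 := by
  unfold F4
  rw [← Set.ncard_image_of_injective (f := fun p : ℕ × ℕ × ℕ × ℕ =>
    [p.1 + p.2.1 + p.2.2.1 + p.2.2.2, p.1 + p.2.1 + p.2.2.1, p.1 + p.2.1, p.1])]
  · congr 1
    ext l
    constructor
    · rintro ⟨⟨h1, h2, h3⟩, h⟩
      rcases l with _ | ⟨x, _ | ⟨y, _ | ⟨z, _ | ⟨w, _ | ⟨v, l⟩⟩⟩⟩⟩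
      · simp [C5, U] at h
      · simp [C5, U] at h
      · simp [C5, U] at h
      · simp [C5, U] at h
      · simp [C5, U] at h
        simp at h1
        simp at h3
        refine ⟨(w, z - w, y - z, x - y), ?_, by simp; omega⟩
        simp
        omega
      · have := h2 v (by simp)
        simp [C5, U] at h
        omega
    · rintro ⟨⟨a, b, c, x⟩, h, rfl⟩
      simp only [Set.mem_ofPred_eq] at h
      refine ⟨⟨?_, ?_, ?_⟩, ?_⟩
      · simp; omega
      · simp; omega
      · simp; omega
      · simp [C5, U]
        omega
  · rintro ⟨a, b, c, d⟩ ⟨a', b', c', d'⟩ h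
    simp at h ⊢
    omega

lemma LS_finite (n : ℕ) : (LS n).Finite := by
  refine (Set.finite_range (fun p : n.Partition => p.parts.sort (· ≥ ·))).subset ?_
  rintro l ⟨h1, h2, h3⟩
  have hs : (l : Multiset ℕ).sort (· ≥ ·) = l := by
    refine List.Perm.eq_of_pairwise' (r := (· ≥ ·)) (Multiset.pairwise_sort _ _) h1 ?_
    rw [← Multiset.coe_eq_coe, Multiset.sort_eq]
  exact ⟨⟨(l : Multiset ℕ), fun {i} hi => h2 i (by simpa using hi), by simpa using h3⟩, hs⟩

lemma R_total {n : ℕ} (hn : 16 < n) :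
    R 4 n = F4 n 1 2 3 4 + F31 n 1 2 3 5 + F22 n 1 2 4 5 + F31 n 3 4 5 1 + F4 n 2 3 4 5 := by
  have fin (P : List ℕ → Prop) : {l ∈ LS n | P l}.Finite := (LS_finite n).subset fun _ h => h.1
  rw [R_list hn, ← case1, ← case2, ← case3, ← case4, ← case5]
  rw [← Set.ncard_union_eq ?_ (fin _) (fin _),
    ← Set.ncard_union_eq ?_ ((fin _).union (fin _)) (fin _),
    ← Set.ncard_union_eq ?_ (((fin _).union (fin _)).union (fin _)) (fin _),
    ← Set.ncard_union_eq ?_ ((((fin _).union (fin _)).union (fin _)).union (fin _)) (fin _)]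
  · congr 1
    ext l
    simp only [Set.mem_union, Set.mem_ofPred_eq, C1, C2, C3, C4, C5, U]
    by_cases hl : l ∈ LS n
    · simp only [hl, true_and]
      omega
    · simp [hl]
  all_goals
    rw [Set.disjoint_left]
    intro l h1 h2
    simp only [Set.mem_union, Set.mem_ofPred_eq, C1, C2, C3, C4, C5] at h1 h2
    omega

theorem R_four_formula (n m a : ℕ) (hn : 16 < n) (ha : a ≤ 11) (hma : n = 12 * m + a) :
    (a = 0 → (R 4 n : ℤ) = 192 * m ^ 3 - 264 * m ^ 2 + 87 * m - 3) ∧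
    (a = 1 → (R 4 n : ℤ) = 192 * m ^ 3 - 216 * m ^ 2 + 44 * m + 5) ∧
    (a = 2 → (R 4 n : ℤ) = 192 * m ^ 3 - 168 * m ^ 2 + 15 * m + 5) ∧
    (a = 3 → (R 4 n : ℤ) = 192 * m ^ 3 - 120 * m ^ 2 - 12 * m + 7) ∧
    (a = 4 → (R 4 n : ℤ) = 192 * m ^ 3 - 72 * m ^ 2 - 25 * m + 4) ∧
    (a = 5 → (R 4 n : ℤ) = 192 * m ^ 3 - 24 * m ^ 2 - 36 * m + 3) ∧
    (a = 6 → (R 4 n : ℤ) = 192 * m ^ 3 + 24 * m ^ 2 - 33 * m - 2) ∧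
    (a = 7 → (R 4 n : ℤ) = 192 * m ^ 3 + 72 * m ^ 2 - 28 * m - 3) ∧
    (a = 8 → (R 4 n : ℤ) = 192 * m ^ 3 + 120 * m ^ 2 - 9 * m - 5) ∧
    (a = 9 → (R 4 n : ℤ) = 192 * m ^ 3 + 168 * m ^ 2 + 12 * m - 5) ∧
    (a = 10 → (R 4 n : ℤ) = 192 * m ^ 3 + 216 * m ^ 2 + 47 * m - 3) ∧
    (a = 11 → (R 4 n : ℤ) = 192 * m ^ 3 + 264 * m ^ 2 + 84 * m + 3) := by
  exact total_formula n m a hn ha hma _ (R_total hn)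
end

section
/- For every integer p ≥ 2 and every n > 16, R_4(n + 12p) ≡ R_4(n) (mod p); that is, R_4 modulo p is periodic with period 12p. -/
section

def PosL : Set (List ℕ) := {l | ∀ x ∈ l, 0 < x}

theorem fin_pos (n : ℕ) : {l : List ℕ | l ∈ PosL ∧ l.sum = n}.Finite := by
  refine (Set.finite_range (fun c : Composition n => c.blocks)).subset ?_
  rintro l ⟨h1, h2⟩
  exact ⟨⟨l, fun {i} hi => h1 i hi, h2⟩, rfl⟩

theorem fin_sub {S : Set (List ℕ)} (hS : S ⊆ PosL) (n : ℕ) : {l : List ℕ | l ∈ S ∧ l.sum = n}.Finite :=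
  (fin_pos n).subset fun _ h => ⟨hS h.1, h.2⟩

noncomputable def cnt (S : Set (List ℕ)) (n : ℕ) : ℕ := {l : List ℕ | l ∈ S ∧ l.sum = n}.ncard

noncomputable def GF (S : Set (List ℕ)) : PowerSeries ℤ := PowerSeries.mk fun n => (cnt S n : ℤ)

theorem GF_union {S T : Set (List ℕ)} (hS : S ⊆ PosL) (hT : T ⊆ PosL) (h : ∀ l, l ∈ S → l ∉ T) :
    GF (S ∪ T) = GF S + GF T := by
  ext n
  simp only [GF, PowerSeries.coeff_mk, map_add]
  rw [← Nat.cast_add]; congr 1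
  unfold cnt
  rw [← Set.ncard_union_eq _ (fin_sub hS n) (fin_sub hT n)]
  · congr 1; ext l; simp
  · rw [Set.disjoint_left]; rintro l ⟨h1, _⟩ ⟨h2, _⟩; exact h l h1 h2

theorem GF_empty : GF ∅ = 0 := by
  ext n; simp [GF, cnt]

theorem GF_nil : GF {[]} = 1 := by
  ext n
  simp only [GF, PowerSeries.coeff_mk, PowerSeries.coeff_one, cnt]
  by_cases h : n = 0
  · subst h
    have : {l : List ℕ | l ∈ ({[]} : Set (List ℕ)) ∧ l.sum = 0} = {[]} := by
      ext l; simp; rintro rfl; simp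
    rw [this]; simp
  · have : {l : List ℕ | l ∈ ({[]} : Set (List ℕ)) ∧ l.sum = n} = ∅ := by
      ext l; simp; rintro rfl; simp; omega
    rw [this]; simp [h]

/-- An injective image that raises the sum by `b`. -/
theorem GF_image (S : Set (List ℕ)) (f : List ℕ → List ℕ) (b : ℕ) (hf : Set.InjOn f S)
    (hs : ∀ l ∈ S, (f l).sum = b + l.sum) : GF (f '' S) = PowerSeries.X ^ b * GF S := by
  ext n
  rw [PowerSeries.coeff_X_pow_mul']
  simp only [GF, PowerSeries.coeff_mk, cnt]
  split_ifs with h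
  · congr 1
    rw [← Set.InjOn.ncard_image (s := {l | l ∈ S ∧ l.sum = n - b}) (f := f)]
    · congr 1; ext l
      simp only [Set.mem_ofPred_eq, Set.mem_image]
      constructor
      · rintro ⟨⟨a, ha, rfl⟩, h2⟩
        refine ⟨a, ⟨ha, ?_⟩, rfl⟩
        have := hs a ha; omega
      · rintro ⟨a, ⟨ha, h2⟩, rfl⟩
        refine ⟨⟨a, ha, rfl⟩, ?_⟩
        have := hs a ha; omega
    · exact hf.mono fun l hl => hl.1
  · have : {l | l ∈ f '' S ∧ l.sum = n} = ∅ := by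
      ext l
      simp only [Set.mem_ofPred_eq, Set.mem_image, Set.mem_empty_iff_false, iff_false]
      rintro ⟨⟨a, ha, rfl⟩, h2⟩
      have := hs a ha; omega
    rw [this]; simp

theorem GF_mul {S T : Set (List ℕ)} (hS : S ⊆ PosL) (hT : T ⊆ PosL) (k : ℕ) (hk : ∀ l ∈ S, l.length = k) :
    GF (Set.image2 (fun t l => t.reverse ++ l) S T) = GF S * GF T := by
  ext n
  rw [PowerSeries.coeff_mul]
  simp only [GF, PowerSeries.coeff_mk, cnt]
  rw [Set.ncard_eq_toFinset_card _ (fin_sub (by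
    rintro _ ⟨t, ht, l, hl, rfl⟩ x hx
    simp only [List.mem_append, List.mem_reverse] at hx
    rcases hx with hx | hx
    · exact hS ht x hx
    · exact hT hl x hx) n)]
  have e : ∀ p : ℕ × ℕ, (({l | l ∈ S ∧ l.sum = p.1}.ncard : ℤ) * ({l | l ∈ T ∧ l.sum = p.2}.ncard : ℤ))
     = (((fin_sub hS p.1).toFinset ×ˢ (fin_sub hT p.2).toFinset).card : ℤ) := by
    intro p
    rw [Finset.card_product, Set.ncard_eq_toFinset_card _ (fin_sub hS p.1),
      Set.ncard_eq_toFinset_card _ (fin_sub hT p.2)]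
    push_cast; rfl
  simp only [e]
  rw [← Nat.cast_sum, ← Finset.card_sigma]
  congr 1
  symm
  refine Finset.card_bij (fun x _ => x.2.1.reverse ++ x.2.2) ?_ ?_ ?_
  · rintro ⟨⟨a, b⟩, t, l⟩ h
    simp only [Finset.mem_sigma, Finset.HasAntidiagonal.mem_antidiagonal, Finset.mem_product, Set.Finite.mem_toFinset,
      Set.mem_ofPred_eq] at h ⊢
    obtain ⟨h1, ⟨h2, h3⟩, h4, h5⟩ := h
    refine ⟨⟨t, h2, l, h4, rfl⟩, ?_⟩
    simp [h3, h5, h1]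
  · rintro ⟨⟨a, b⟩, t, l⟩ h ⟨⟨a', b'⟩, t', l'⟩ h' hh
    simp only [Finset.mem_sigma, Finset.HasAntidiagonal.mem_antidiagonal, Finset.mem_product, Set.Finite.mem_toFinset,
      Set.mem_ofPred_eq] at h h' hh
    obtain ⟨h1, ⟨h2, h3⟩, h4, h5⟩ := h
    obtain ⟨h1', ⟨h2', h3'⟩, h4', h5'⟩ := h'
    have := List.append_inj hh (by simp [hk t h2, hk t' h2'])
    obtain ⟨q1, q2⟩ := this
    have q1 := List.reverse_injective q1
    subst q1 q2 h3 h5 h3' h5'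
    rfl
  · intro x hx
    simp only [Set.Finite.mem_toFinset, Set.mem_ofPred_eq] at hx
    obtain ⟨⟨t, ht, l, hl, rfl⟩, hs⟩ := hx
    refine ⟨⟨⟨t.sum, l.sum⟩, t, l⟩, ?_, rfl⟩
    simp only [Finset.mem_sigma, Finset.HasAntidiagonal.mem_antidiagonal, Finset.mem_product, Set.Finite.mem_toFinset,
      Set.mem_ofPred_eq]
    simp at hs
    exact ⟨hs, ⟨ht, trivial⟩, hl, trivial⟩

end

/-- Weakly decreasing positive lists with entries at most the bound. -/
def dec : ℕ → List ℕ → Prop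
  | _, [] => True
  | b, x :: l => 1 ≤ x ∧ x ≤ b ∧ dec x l

theorem dec_pos : ∀ (l : List ℕ) (b : ℕ), dec b l → l ∈ PosL
  | [], _, _ => by simp [PosL]
  | x :: l, b, h => by
    have := dec_pos l x h.2.2
    simp only [PosL, Set.mem_ofPred_eq, List.mem_cons] at this ⊢
    rintro y (rfl | hy)
    · exact h.1
    · exact this y hy

theorem dec_le : ∀ (l : List ℕ) (b : ℕ), dec b l → ∀ i, l.getD i 0 ≤ b
  | [], _, _ => by simp
  | x :: l, b, h => by
    intro i
    cases i with
    | zero => simpa using h.2.1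
    | succ i => have := dec_le l x h.2.2 i; simp at this ⊢; exact this.trans h.2.1

theorem dec_mono {b c : ℕ} (hbc : b ≤ c) : ∀ l, dec b l → dec c l
  | [], _ => trivial
  | _ :: _, h => ⟨h.1, h.2.1.trans hbc, h.2.2⟩

def BotL (M m j : ℕ) : Set (List ℕ) :=
  {l | dec m l ∧ ∀ v, 1 ≤ v → v ≤ m → v + j ≤ M → v ≤ l.getD (M - v - j) 0}

theorem Bot_pos (M m j : ℕ) : BotL M m j ⊆ PosL := fun l h => dec_pos l m h.1

theorem Bot_zero (M j : ℕ) : BotL M 0 j = {[]} := by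
  ext l
  simp only [BotL, Set.mem_ofPred_eq, Set.mem_singleton_iff]
  constructor
  · rintro ⟨h, _⟩
    cases l with
    | nil => rfl
    | cons x l => have := h.1; have := h.2.1; omega
  · rintro rfl
    exact ⟨trivial, by omega⟩

theorem Bot_sat (M m j : ℕ) (h : M ≤ j) : BotL M m (j + 1) = BotL M m j := by
  ext l
  simp only [BotL, Set.mem_ofPred_eq]
  constructor
  · rintro ⟨h, _⟩
    exact ⟨h, by omega⟩
  · rintro ⟨h, _⟩
    exact ⟨h, by omega⟩

theorem Bot_split (M m j : ℕ) :
    BotL M (m + 1) j = (fun l => (m + 1) :: l) '' BotL M (m + 1) (j + 1)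
      ∪ {l | l ∈ BotL M m j ∧ M < m + 1 + j} := by
  ext l
  simp only [BotL, Set.mem_union, Set.mem_image, Set.mem_ofPred_eq]
  constructor
  · rintro ⟨h1, h2⟩
    by_cases hl : ∃ l', l = (m + 1) :: l'
    · left
      obtain ⟨l', rfl⟩ := hl
      refine ⟨l', ⟨h1.2.2, ?_⟩, rfl⟩
      intro v hv1 hv2 hv3
      have := h2 v hv1 hv2 (by omega)
      rw [show M - v - j = (M - v - (j + 1)) + 1 by omega] at this
      simpa using this
    · right
      have hd : dec m l := by
        cases l with
        | nil => trivial
        | cons x l =>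
          refine ⟨h1.1, ?_, h1.2.2⟩
          have := h1.2.1
          have : x ≠ m + 1 := by rintro rfl; exact hl ⟨l, rfl⟩
          omega
      refine ⟨⟨hd, fun v a b c => h2 v a (by omega) c⟩, ?_⟩
      by_contra hc
      have a := h2 (m + 1) (by omega) le_rfl (by omega)
      have b := dec_le l m hd (M - (m + 1) - j)
      omega
  · rintro (⟨l', ⟨h1, h2⟩, rfl⟩ | ⟨⟨h1, h2⟩, h3⟩)
    · refine ⟨⟨by omega, le_rfl, h1⟩, ?_⟩
      intro v a b c
      by_cases hv : v + j = M
      · rw [show M - v - j = 0 by omega]; simpa using b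
      · have := h2 v a b (by omega)
        rw [show M - v - j = (M - v - (j + 1)) + 1 by omega]
        simpa using this
    · refine ⟨dec_mono (by omega) l h1, ?_⟩
      intro v a b c
      exact h2 v a (by omega) c

theorem GF_cons (S : Set (List ℕ)) (b : ℕ) :
    GF ((fun l => b :: l) '' S) = PowerSeries.X ^ b * GF S :=
  GF_image S _ b (fun _ _ _ _ h => (List.cons.inj h).2) (fun l _ => by simp)

theorem Bot_disj (M m j : ℕ) (l) (h : l ∈ (fun l => (m + 1) :: l) '' BotL M (m + 1) (j + 1)) :
    l ∉ BotL M m j := by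
  obtain ⟨l', -, rfl⟩ := h
  rintro ⟨h, -⟩
  have := h.2.1
  omega

theorem GF_Bot_one (M m j : ℕ) (h : M < m + 1 + j) : GF (BotL M (m + 1) j) =
    PowerSeries.X ^ (m + 1) * GF (BotL M (m + 1) (j + 1)) + GF (BotL M m j) := by
  rw [Bot_split]
  have : {l | l ∈ BotL M m j ∧ M < m + 1 + j} = BotL M m j := by ext l; simp [h]
  rw [this, GF_union _ (Bot_pos _ _ _) (Bot_disj M m j), GF_cons]
  rintro _ ⟨l, hl, rfl⟩ x hx
  rcases List.mem_cons.1 hx with rfl | hx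
  · omega
  · exact Bot_pos _ _ _ hl x hx

theorem GF_Bot_two (M m j : ℕ) (h : m + 1 + j ≤ M) : GF (BotL M (m + 1) j) =
    PowerSeries.X ^ (m + 1) * GF (BotL M (m + 1) (j + 1)) := by
  rw [Bot_split]
  have : {l | l ∈ BotL M m j ∧ M < m + 1 + j} = ∅ := by ext l; simp; omega
  rw [this, Set.union_empty, GF_cons]

theorem GF_Bot_sat (M m : ℕ) : GF (BotL M (m + 1) M) * (1 - PowerSeries.X ^ (m + 1)) = GF (BotL M m M) := by
  have := GF_Bot_one M m M (by omega)
  rw [Bot_sat M _ M le_rfl] at this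
  linear_combination this

/-- Weakly increasing lists, entries at least `b`, with prescribed lower bounds. -/
def ok : List ℕ → ℕ → List ℕ → Prop
  | [], _, [] => True
  | [], _, _ :: _ => False
  | _ :: _, _, [] => False
  | a :: L, b, c :: l => a ≤ c ∧ b ≤ c ∧ ok L c l

def TopL (L : List ℕ) (b : ℕ) : Set (List ℕ) := {l | 1 ≤ b ∧ ok L b l}

theorem ok_pos : ∀ (L l : List ℕ) (b : ℕ), 1 ≤ b → ok L b l → l ∈ PosL
  | [], [], _, _, _ => by simp [PosL]
  | a :: L, c :: l, b, hb, h => by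
    have := ok_pos L l c (hb.trans h.2.1) h.2.2
    simp only [PosL, Set.mem_ofPred_eq, List.mem_cons] at this ⊢
    rintro y (rfl | hy)
    · exact hb.trans h.2.1
    · exact this y hy

theorem Top_pos (L b) : TopL L b ⊆ PosL := fun l h => ok_pos L l b h.1 h.2

theorem ok_length : ∀ (L l : List ℕ) (b : ℕ), ok L b l → l.length = L.length
  | [], [], _, _ => rfl
  | a :: L, c :: l, b, h => by simp [ok_length L l c h.2.2]

theorem Top_length (L b) : ∀ l ∈ TopL L b, l.length = L.length := fun l h => ok_length L l b h.2

theorem GF_Top_nil (b : ℕ) (hb : 1 ≤ b) : GF (TopL [] b) = 1 := by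
  rw [← GF_nil]; congr 1; ext l
  cases l <;> simp [TopL, ok, hb]

theorem Top_low (a : ℕ) (L : List ℕ) (b : ℕ) (hb : 1 ≤ b) (h : b ≤ a) : TopL (a :: L) b = TopL (a :: L) a := by
  ext l
  cases l with
  | nil => simp [TopL, ok]
  | cons c l => simp only [TopL, ok, Set.mem_ofPred_eq]; constructor <;> (rintro ⟨h1, h2, h3, h4⟩; exact ⟨by omega, by omega, by omega, h4⟩)

theorem GF_Top_cons (a : ℕ) (L : List ℕ) (b : ℕ) (hb : 1 ≤ b) (h : a ≤ b) : GF (TopL (a :: L) b) =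
    PowerSeries.X ^ b * GF (TopL L b) + GF (TopL (a :: L) (b + 1)) := by
  have : TopL (a :: L) b = (fun l => b :: l) '' TopL L b ∪ TopL (a :: L) (b + 1) := by
    ext l
    cases l with
    | nil => simp [TopL, ok]
    | cons c l =>
      simp only [TopL, ok, Set.mem_ofPred_eq, Set.mem_union, Set.mem_image, List.cons.injEq]
      constructor
      · rintro ⟨h1, h2, h3, h4⟩
        by_cases hc : b = c
        · subst hc; left; exact ⟨l, ⟨h1, h4⟩, rfl, rfl⟩
        · right; exact ⟨by omega, by omega, by omega, h4⟩
      · rintro (⟨l', ⟨h1, h2⟩, rfl, rfl⟩ | ⟨h1, h2, h3, h4⟩)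
        · exact ⟨h1, h, le_rfl, h2⟩
        · exact ⟨by omega, h2, by omega, h4⟩
  rw [this, GF_union _ (Top_pos _ _), GF_cons]
  · rintro _ ⟨l', -, rfl⟩ ⟨_, h⟩
    have := h.2.1; omega
  · rintro _ ⟨l, hl, rfl⟩ x hx
    rcases List.mem_cons.1 hx with rfl | hx
    · omega
    · exact Top_pos _ _ hl x hx

theorem ok_shift : ∀ (L : List ℕ) (b : ℕ), (∀ a ∈ L, a ≤ b) → ∀ l,
    ok L (b + 1) l ↔ ∃ l', ok L b l' ∧ l'.map (· + 1) = l
  | [], b, _, l => by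
    cases l with
    | nil => simp [ok]
    | cons c l =>
      simp only [ok, false_iff]
      rintro ⟨_ | ⟨x, l'⟩, h, h'⟩
      · simp at h'
      · exact h
  | a :: L, b, hab, l => by
    simp only [List.mem_cons, forall_eq_or_imp] at hab
    cases l with
    | nil =>
      simp only [ok, false_iff]
      rintro ⟨_ | ⟨x, l'⟩, h, h'⟩
      · exact h
      · simp at h'
    | cons c l =>
      constructor
      · rintro ⟨h1, h2, h3⟩
        obtain ⟨c, rfl⟩ : ∃ d, c = d + 1 := ⟨c - 1, by omega⟩
        obtain ⟨l', h4, rfl⟩ := (ok_shift L c (fun a ha => (hab.2 a ha).trans (by omega)) l).1 h3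
        exact ⟨c :: l', ⟨by omega, by omega, h4⟩, by simp⟩
      · rintro ⟨_ | ⟨x, l'⟩, h, h'⟩
        · simp at h'
        · simp only [List.map_cons, List.cons.injEq] at h'
          obtain ⟨rfl, rfl⟩ := h'
          have h2 := h.2.1
          exact ⟨by have := hab.1; omega, by omega,
            (ok_shift L x (fun a ha => (hab.2 a ha).trans (by omega)) _).2 ⟨l', h.2.2, rfl⟩⟩

theorem GF_Top_shift (L : List ℕ) (b : ℕ) (hb : 1 ≤ b) (h : ∀ a ∈ L, a ≤ b) :
    GF (TopL L (b + 1)) = PowerSeries.X ^ L.length * GF (TopL L b) := by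
  rw [← GF_image (TopL L b) (fun l => l.map (· + 1))]
  · congr 1; ext l
    simp only [TopL, Set.mem_ofPred_eq, Set.mem_image, ok_shift L b h l]
    constructor
    · rintro ⟨-, l', h1, h2⟩; exact ⟨l', ⟨hb, h1⟩, h2⟩
    · rintro ⟨l', ⟨-, h1⟩, h2⟩; exact ⟨by omega, l', h1, h2⟩
  · intro x _ y _ hxy
    exact List.map_injective_iff.2 (fun a b h => by simpa using h) hxy
  · intro l hl
    have := Top_length L b l hl
    rw [← this]
    clear this hl
    induction l with
    | nil => simp
    | cons x l ih => simp only [List.map_cons, List.sum_cons, List.length_cons] at *; omega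

theorem GF_Top_sat (a : ℕ) (L : List ℕ) (b : ℕ) (hb : 1 ≤ b) (h : ∀ x ∈ a :: L, x ≤ b) :
    GF (TopL (a :: L) b) * (1 - PowerSeries.X ^ (L.length + 1)) = PowerSeries.X ^ b * GF (TopL L b) := by
  have h1 := GF_Top_cons a L b hb (h a (by simp))
  have h2 := GF_Top_shift (a :: L) b hb h
  rw [h2] at h1
  simp only [List.length_cons] at h1
  linear_combination h1

def DL : Set (List ℕ) := {l | (∃ b, dec b l) ∧
  (4 ≤ l.getD 0 0 ∧ 3 ≤ l.getD 1 0 ∧ 2 ≤ l.getD 2 0 ∧ 1 ≤ l.getD 3 0) ∧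
  ¬ (5 ≤ l.getD 0 0 ∧ 4 ≤ l.getD 1 0 ∧ 3 ≤ l.getD 2 0 ∧ 2 ≤ l.getD 3 0 ∧ 1 ≤ l.getD 4 0)}

theorem DL_pos : DL ⊆ PosL := fun l ⟨⟨b, h⟩, _⟩ => dec_pos l b h

/-- Members of `DL` whose first row failing the bound of the next staircase is row `k`. -/
def CL (k : ℕ) : Set (List ℕ) := {l | l ∈ DL ∧ (∀ i < k, 5 - i ≤ l.getD i 0) ∧ l.getD k 0 < 5 - k}

theorem CL_pos (k) : CL k ⊆ PosL := fun _ h => DL_pos h.1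

theorem CL_disj {j k : ℕ} (h : j < k) (l) (h1 : l ∈ CL j) : l ∉ CL k := by
  rintro ⟨_, h2, _⟩
  have := h2 j h
  have := h1.2.2
  omega

theorem DL_eq : DL = CL 0 ∪ (CL 1 ∪ (CL 2 ∪ (CL 3 ∪ CL 4))) := by
  ext l
  simp only [Set.mem_union, CL, Set.mem_ofPred_eq]
  constructor
  · intro h
    have h5 := h.2.2
    simp only [h, true_and]
    by_cases h0 : 5 ≤ l.getD 0 0
    swap
    · left; exact ⟨by omega, by omega⟩
    by_cases h1 : 4 ≤ l.getD 1 0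
    swap
    · right; left; exact ⟨fun i hi => by interval_cases i; exact h0, by omega⟩
    by_cases h2 : 3 ≤ l.getD 2 0
    swap
    · right; right; left; exact ⟨fun i hi => by interval_cases i; exacts [h0, h1], by omega⟩
    by_cases h3 : 2 ≤ l.getD 3 0
    swap
    · right; right; right; left; exact ⟨fun i hi => by interval_cases i; exacts [h0, h1, h2], by omega⟩
    · right; right; right; right
      exact ⟨fun i hi => by interval_cases i; exacts [h0, h1, h2, h3], by omega⟩
  · tauto

theorem dec_of_getD {b c : ℕ} : ∀ l, dec b l → l.getD 0 0 ≤ c → dec c l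
  | [], _, _ => trivial
  | _ :: _, h, h' => ⟨h.1, by simpa using h', h.2.2⟩

theorem GF_DL : GF DL = GF (CL 0) + (GF (CL 1) + (GF (CL 2) + (GF (CL 3) + GF (CL 4)))) := by
  have u : ∀ {A B : Set (List ℕ)}, A ⊆ PosL → B ⊆ PosL → A ∪ B ⊆ PosL := fun a b => Set.union_subset a b
  have p := CL_pos
  have d : ∀ j k : ℕ, j < k → ∀ l, l ∈ CL j → l ∉ CL k := fun j k h l => CL_disj h l
  rw [DL_eq, GF_union (p 0) (u (p 1) (u (p 2) (u (p 3) (p 4)))),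
    GF_union (p 1) (u (p 2) (u (p 3) (p 4))), GF_union (p 2) (u (p 3) (p 4)), GF_union (p 3) (p 4)]
  · exact d 3 4 (by omega)
  · rintro l h (h' | h')
    · exact d 2 3 (by omega) l h h'
    · exact d 2 4 (by omega) l h h'
  · rintro l h (h' | h' | h')
    · exact d 1 2 (by omega) l h h'
    · exact d 1 3 (by omega) l h h'
    · exact d 1 4 (by omega) l h h'
  · rintro l h (h' | h' | h' | h')
    · exact d 0 1 (by omega) l h h'
    · exact d 0 2 (by omega) l h h'
    · exact d 0 3 (by omega) l h h'
    · exact d 0 4 (by omega) l h h'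

theorem exists_cons {l : List ℕ} (h : 1 ≤ l.getD 0 0) : ∃ a l', l = a :: l' := by
  cases l with
  | nil => simp at h
  | cons a l => exact ⟨a, l, rfl⟩

abbrev comb (S T : Set (List ℕ)) := Set.image2 (fun t l : List ℕ => t.reverse ++ l) S T

theorem CL0 : CL 0 = comb (TopL [] 1) (BotL 4 4 0) := by
  ext l
  constructor
  · rintro ⟨⟨⟨b, hb⟩, ⟨h1, h2, h3, h4⟩, h5⟩, h6, h7⟩
    refine ⟨[], by simp [TopL, ok], l, ⟨dec_of_getD l hb (by omega), ?_⟩, by simp⟩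
    intro v a b c
    interval_cases v <;> assumption
  · rintro ⟨t, ⟨-, ht⟩, l, ⟨h1, h2⟩, rfl⟩
    match t, ht with
    | [], _ =>
    have e1 := h2 1 (by omega) (by omega) (by omega)
    have e2 := h2 2 (by omega) (by omega) (by omega)
    have e3 := h2 3 (by omega) (by omega) (by omega)
    have e4 := h2 4 (by omega) (by omega) (by omega)
    have e5 := dec_le l _ h1 0
    simp at e1 e2 e3 e4 e5
    refine ⟨⟨⟨4, by simpa using h1⟩, ?_, ?_⟩, ?_, ?_⟩
    · simp; omega
    · simp; omega
    · omega
    · simp; omega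

theorem CL1 : CL 1 = comb (TopL [5] 1) (BotL 3 3 0) := by
  ext l
  constructor
  · rintro ⟨⟨⟨b, hb⟩, ⟨h1, h2, h3, h4⟩, h5⟩, h6, h7⟩
    obtain ⟨x, l, rfl⟩ := exists_cons (l := l) (by omega)
    have g0 := h6 0 (by omega)
    simp at h1 h2 h3 h4 h7 g0
    refine ⟨[x], by simp [TopL, ok]; omega, l, ⟨dec_of_getD l hb.2.2 (by simp; omega), ?_⟩, by simp⟩
    intro v a b c
    interval_cases v <;> simpa
  · rintro ⟨t, ⟨-, ht⟩, l, ⟨h1, h2⟩, rfl⟩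
    match t, ht with
    | [x], ht =>
    simp only [ok] at ht
    have e1 := h2 1 (by omega) (by omega) (by omega)
    have e2 := h2 2 (by omega) (by omega) (by omega)
    have e3 := h2 3 (by omega) (by omega) (by omega)
    have e5 := dec_le l _ h1 0
    simp at e1 e2 e3 e5
    refine ⟨⟨⟨x, by omega, by omega, dec_mono (by omega) l h1⟩, ?_, ?_⟩, ?_, ?_⟩
    · simp; omega
    · simp; omega
    · intro i hi; interval_cases i <;> simp <;> omega
    · simp; omega

theorem CL2 : CL 2 = comb (TopL [4, 5] 1) (BotL 2 2 0) := by
  ext l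
  constructor
  · rintro ⟨⟨⟨b, hb⟩, ⟨h1, h2, h3, h4⟩, h5⟩, h6, h7⟩
    obtain ⟨x, l, rfl⟩ := exists_cons (l := l) (by omega)
    obtain ⟨y, l, rfl⟩ := exists_cons (l := l) (by simp at h2 ⊢; omega)
    have g0 := h6 0 (by omega)
    have g1 := h6 1 (by omega)
    simp at h1 h2 h3 h4 h7 g0 g1
    have d1 := hb.2.2.2.1
    refine ⟨[y, x], by simp [TopL, ok]; omega, l, ⟨dec_of_getD l hb.2.2.2.2 (by simp; omega), ?_⟩, by simp⟩
    intro v a b c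
    interval_cases v <;> simpa
  · rintro ⟨t, ⟨-, ht⟩, l, ⟨h1, h2⟩, rfl⟩
    match t, ht with
    | [y, x], ht =>
    simp only [ok] at ht
    have e1 := h2 1 (by omega) (by omega) (by omega)
    have e2 := h2 2 (by omega) (by omega) (by omega)
    have e5 := dec_le l _ h1 0
    simp at e1 e2 e5
    refine ⟨⟨⟨x, by omega, by omega, by omega, by omega, dec_mono (by omega) l h1⟩, ?_, ?_⟩, ?_, ?_⟩
    · simp; omega
    · simp; omega
    · intro i hi; interval_cases i <;> simp <;> omega
    · simp; omega

theorem CL3 : CL 3 = comb (TopL [3, 4, 5] 1) (BotL 1 1 0) := by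
  ext l
  constructor
  · rintro ⟨⟨⟨b, hb⟩, ⟨h1, h2, h3, h4⟩, h5⟩, h6, h7⟩
    obtain ⟨x, l, rfl⟩ := exists_cons (l := l) (by omega)
    obtain ⟨y, l, rfl⟩ := exists_cons (l := l) (by simp at h2 ⊢; omega)
    obtain ⟨z, l, rfl⟩ := exists_cons (l := l) (by simp at h3 ⊢; omega)
    have g0 := h6 0 (by omega)
    have g1 := h6 1 (by omega)
    have g2 := h6 2 (by omega)
    simp at h1 h2 h3 h4 h7 g0 g1 g2
    have d1 := hb.2.2.2.1
    have d2 := hb.2.2.2.2.2.1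
    refine ⟨[z, y, x], by simp [TopL, ok]; omega, l, ⟨dec_of_getD l hb.2.2.2.2.2.2 (by simp; omega), ?_⟩, by simp⟩
    intro v a b c
    interval_cases v
    simp
    omega
  · rintro ⟨t, ⟨-, ht⟩, l, ⟨h1, h2⟩, rfl⟩
    match t, ht with
    | [z, y, x], ht =>
    simp only [ok] at ht
    have e1 := h2 1 (by omega) (by omega) (by omega)
    have e5 := dec_le l _ h1 0
    simp at e1 e5
    refine ⟨⟨⟨x, by omega, by omega, by omega, by omega, by omega, by omega, dec_mono (by omega) l h1⟩, ?_, ?_⟩, ?_, ?_⟩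
    · simp; omega
    · simp; omega
    · intro i hi; interval_cases i <;> simp <;> omega
    · simp; omega

theorem CL4 : CL 4 = comb (TopL [2, 3, 4, 5] 1) (BotL 0 0 0) := by
  ext l
  constructor
  · rintro ⟨⟨⟨b, hb⟩, ⟨h1, h2, h3, h4⟩, h5⟩, h6, h7⟩
    obtain ⟨x, l, rfl⟩ := exists_cons (l := l) (by omega)
    obtain ⟨y, l, rfl⟩ := exists_cons (l := l) (by simp at h2 ⊢; omega)
    obtain ⟨z, l, rfl⟩ := exists_cons (l := l) (by simp at h3 ⊢; omega)
    obtain ⟨w, l, rfl⟩ := exists_cons (l := l) (by simp at h4 ⊢; omega)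
    have g0 := h6 0 (by omega)
    have g1 := h6 1 (by omega)
    have g2 := h6 2 (by omega)
    have g3 := h6 3 (by omega)
    simp at h1 h2 h3 h4 h7 g0 g1 g2 g3
    have d1 := hb.2.2.2.1
    have d2 := hb.2.2.2.2.2.1
    have d3 := hb.2.2.2.2.2.2.2.1
    refine ⟨[w, z, y, x], by simp [TopL, ok]; omega, l, ⟨dec_of_getD l hb.2.2.2.2.2.2.2.2 (by simp; omega), ?_⟩, by simp⟩
    intro v a b c
    omega
  · rintro ⟨t, ⟨-, ht⟩, l, ⟨h1, h2⟩, rfl⟩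
    match t, ht with
    | [w, z, y, x], ht =>
    simp only [ok] at ht
    have e5 := dec_le l _ h1 0
    simp at e5
    refine ⟨⟨⟨x, by omega, by omega, by omega, by omega, by omega, by omega, by omega, by omega,
      dec_mono (by omega) l h1⟩, ?_, ?_⟩, ?_, ?_⟩
    · simp; omega
    · simp; omega
    · intro i hi; interval_cases i <;> simp <;> omega
    · simp; omega

theorem GF_comb (L : List ℕ) (M : ℕ) : GF (comb (TopL L 1) (BotL M M 0)) = GF (TopL L 1) * GF (BotL M M 0) :=
  GF_mul (Top_pos _ _) (Bot_pos _ _ _) L.length (Top_length _ _)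

theorem GF_DL' : GF DL = GF (TopL [] 1) * GF (BotL 4 4 0) + (GF (TopL [5] 1) * GF (BotL 3 3 0)
    + (GF (TopL [4, 5] 1) * GF (BotL 2 2 0) + (GF (TopL [3, 4, 5] 1) * GF (BotL 1 1 0)
    + GF (TopL [2, 3, 4, 5] 1) * GF (BotL 0 0 0)))) := by
  rw [GF_DL, CL0, CL1, CL2, CL3, CL4]
  simp only [GF_comb]

theorem dec_of_sorted : ∀ l : List ℕ, l.Pairwise (· ≥ ·) → l ∈ PosL → dec (l.getD 0 0) l
  | [], _, _ => trivial
  | a :: l, h, hp => by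
    rw [List.pairwise_cons] at h
    have hp' : l ∈ PosL := fun x hx => hp x (List.mem_cons_of_mem _ hx)
    refine ⟨hp a (by simp), by simp, dec_mono ?_ l (dec_of_sorted l h.2 hp')⟩
    cases l with
    | nil => simp
    | cons b l => simpa using h.1 b (by simp)

theorem dec_mem : ∀ (l : List ℕ) (b : ℕ), dec b l → ∀ x ∈ l, x ≤ b
  | [], _, _ => by simp
  | a :: l, b, h => by
    have := dec_mem l a h.2.2
    intro x hx
    rcases List.mem_cons.1 hx with rfl | hx
    · exact h.2.1
    · exact (this x hx).trans h.2.1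

theorem sorted_of_dec : ∀ (l : List ℕ) (b : ℕ), dec b l → l.Pairwise (· ≥ ·)
  | [], _, _ => List.Pairwise.nil
  | a :: l, b, h => List.Pairwise.cons (dec_mem l a h.2.2) (sorted_of_dec l a h.2.2)

theorem fg_iff (P : ℕ → Prop) (inst : DecidablePred P) (k m : ℕ) :
    @Nat.findGreatest P inst k = m ↔ m ≤ k ∧ (m ≠ 0 → P m) ∧ ∀ ⦃n⦄, m < n → n ≤ k → ¬P n :=
  Nat.findGreatest_eq_iff

theorem durfee_iff {n : ℕ} (p : n.Partition) : durfee p = 4 ↔ p.parts.sort (· ≥ ·) ∈ DL := by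
  have hs : (p.parts.sort (· ≥ ·)).sum = n := by
    rw [← Multiset.sum_coe, Multiset.sort_eq, p.parts_sum]
  have hd : dec ((p.parts.sort (· ≥ ·)).getD 0 0) (p.parts.sort (· ≥ ·)) := by
    apply dec_of_sorted
    · exact Multiset.pairwise_sort _ _
    · intro x hx
      rw [Multiset.mem_sort] at hx
      exact p.parts_pos hx
  have hle : (p.parts.sort (· ≥ ·)).getD 0 0 ≤ n := by
    refine le_trans ?_ hs.le
    cases p.parts.sort (· ≥ ·) <;> simp
  have q : ∀ i, part p (i + 1) = (p.parts.sort (· ≥ ·)).getD i 0 := fun i => rfl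
  unfold durfee
  refine Iff.trans (fg_iff _ _ _ _) ?_
  have key : ∀ k, (∀ i ∈ Finset.Icc 1 k, k + 1 ≤ part p i + i) ↔
      ∀ i < k, k ≤ (p.parts.sort (· ≥ ·)).getD i 0 + i := by
    intro k
    constructor
    · intro h i hi
      have := h (i + 1) (by simp; omega)
      rw [q] at this; omega
    · intro h i hi
      rw [Finset.mem_Icc] at hi
      obtain ⟨j, rfl⟩ : ∃ j, i = j + 1 := ⟨i - 1, by omega⟩
      have := h j (by omega)
      rw [q]; omega
  simp only [key]
  generalize p.parts.sort (· ≥ ·) = l at *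
  constructor
  · rintro ⟨h1, h2, h3⟩
    have h2 := h2 (by omega)
    refine ⟨⟨_, hd⟩, ⟨?_, ?_, ?_, ?_⟩, ?_⟩
    · have := h2 0; omega
    · have := h2 1; omega
    · have := h2 2; omega
    · have := h2 3; omega
    · rintro ⟨g0, g1, g2, g3, g4⟩
      refine h3 (n := 5) (by omega) (by omega) ?_
      intro i hi
      interval_cases i <;> omega
  · rintro ⟨-, ⟨h0, h1, h2, h3⟩, h5⟩
    refine ⟨by omega, fun _ i hi => by interval_cases i <;> omega, ?_⟩
    intro k hk hkn h
    apply h5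
    have g0 := h 0 (by omega)
    have g1 := h 1 (by omega)
    have g2 := h 2 (by omega)
    have g3 := h 3 (by omega)
    have g4 := h 4 (by omega)
    omega

theorem R_eq (n : ℕ) : R 4 n = cnt DL n := by
  unfold R cnt
  rw [Set.ncard_eq_toFinset_card _ (fin_sub DL_pos n)]
  refine Finset.card_bij (fun p _ => p.parts.sort (· ≥ ·)) ?_ ?_ ?_
  · intro p hp
    simp only [Finset.mem_filter, Finset.mem_univ, true_and] at hp
    simp only [Set.Finite.mem_toFinset, Set.mem_ofPred_eq]
    refine ⟨(durfee_iff p).1 hp, ?_⟩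
    rw [← Multiset.sum_coe, Multiset.sort_eq, p.parts_sum]
  · intro p _ p' _ h
    have := congrArg (fun l : List ℕ => (l : Multiset ℕ)) h
    simp only [Multiset.sort_eq] at this
    exact Nat.Partition.ext this
  · intro l hl
    simp only [Set.Finite.mem_toFinset, Set.mem_ofPred_eq] at hl
    obtain ⟨h1, h2⟩ := hl
    have e : (l : Multiset ℕ).sort (· ≥ ·) = l := by
      obtain ⟨⟨b, hb⟩, -⟩ := h1
      rw [Multiset.coe_sort]
      exact List.mergeSort_eq_self _ (by simpa using sorted_of_dec l b hb)
    refine ⟨⟨(l : Multiset ℕ), fun {i} hi => DL_pos h1 i (by simpa using hi), by simpa using h2⟩, ?_, e⟩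
    simp only [Finset.mem_filter, Finset.mem_univ, true_and]
    rw [durfee_iff]
    simpa [e] using h1

section
open PowerSeries

noncomputable def VV (f : ℕ → ℤ) : PowerSeries ℤ := PowerSeries.mk fun n => if 12 ∣ n then f (n / 12) else 0

theorem VV_mul (f g : ℕ → ℤ) (h0 : f 0 = g 0) (h : ∀ m, f (m + 1) - f m = g (m + 1)) :
    VV f * (1 - X ^ 12) = VV g := by
  ext n
  rw [mul_sub, mul_one, map_sub, coeff_mul_X_pow']
  simp only [VV, coeff_mk]
  by_cases hd : 12 ∣ n
  · obtain ⟨m, rfl⟩ := hd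
    cases m with
    | zero => simp [h0]
    | succ m =>
      rw [show 12 * (m + 1) - 12 = 12 * m by omega, if_pos (by omega)]
      simp [h]
  · split_ifs <;> first | omega | simp

theorem VV_one : VV (fun _ => 1) * (1 - X ^ 12) = 1 := by
  rw [VV_mul _ (fun m => if m = 0 then 1 else 0) (by simp) (by simp)]
  ext n
  simp only [VV, coeff_mk, coeff_one]
  split_ifs <;> first | omega | rfl

def Per (p : ℕ) (F : PowerSeries ℤ) : Prop :=
  ∀ n, 17 ≤ n → (p : ℤ) ∣ coeff (n + 12 * p) F - coeff n F

theorem Per.add {p F G} (hF : Per p F) (hG : Per p G) : Per p (F + G) := by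
  intro n hn
  obtain ⟨c, hc⟩ := hF n hn
  obtain ⟨d, hd⟩ := hG n hn
  refine ⟨c + d, ?_⟩
  simp only [map_add]
  linear_combination hc + hd

theorem Per.smul {p F} (a : ℤ) (hF : Per p F) : Per p (C a * F) := by
  intro n hn
  obtain ⟨c, hc⟩ := hF n hn
  refine ⟨a * c, ?_⟩
  simp only [coeff_C_mul]
  linear_combination a * hc

theorem Per.low (p k : ℕ) (hk : k < 17) : Per p (X ^ k) := by
  intro n hn
  rw [coeff_X_pow, coeff_X_pow, if_neg (by omega), if_neg (by omega)]
  simp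

theorem Per.VV {p : ℕ} (f : ℕ → ℤ) (hf : ∀ m, (p : ℤ) ∣ f (m + p) - f m) (r : ℕ) (hr : r < 12) :
    Per p (X ^ (17 + r) * VV f) := by
  intro n hn
  rw [coeff_X_pow_mul', coeff_X_pow_mul']
  simp only [_root_.VV, coeff_mk]
  by_cases h : 17 + r ≤ n
  · obtain ⟨k, rfl⟩ : ∃ k, n = 17 + r + k := ⟨n - (17 + r), by omega⟩
    rw [if_pos (show 17 + r ≤ 17 + r + k + 12 * p by omega), if_pos h, show 17 + r + k + 12 * p - (17 + r) = k + 12 * p by omega,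
      show 17 + r + k - (17 + r) = k by omega]
    by_cases hd : 12 ∣ k
    · rw [if_pos hd, if_pos (show 12 ∣ k + 12 * p by omega), show (k + 12 * p) / 12 = k / 12 + p by omega]
      exact hf _
    · rw [if_neg hd, if_neg (show ¬ 12 ∣ k + 12 * p by omega)]; simp
  · rw [if_neg h]
    split_ifs with h1 h2
    · omega
    · simp
    · simp

theorem Per.sum {p : ℕ} (F : ℕ → PowerSeries ℤ) (N : ℕ) (h : ∀ r < N, Per p (F r)) :
    Per p (∑ r ∈ Finset.range N, F r) := by
  induction N with
  | zero => intro n _; simp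
  | succ N ih =>
    rw [Finset.sum_range_succ]
    exact (ih fun r hr => h r (by omega)).add (h N (by omega))

def cP : ℕ → ℤ := fun n => ([0, 0, 0, 0, 0, 0, 0, 0, 0, 0, 1, 5, 12, 24, 42, 66, 98] : List ℤ).getD n 0
def cA : ℕ → ℤ := fun n => ([3, -2, -3, -5, -5, -3, 3, 12, 25, 44, 67, 99] : List ℤ).getD n 0
def cB : ℕ → ℤ := fun n => ([180, 135, 92, 63, 36, 23, 12, 15, 20, 39, 60, 95] : List ℤ).getD n 0
def cC : ℕ → ℤ := fun n => ([-600, -552, -504, -456, -408, -360, -312, -264, -216, -168, -120, -72] : List ℤ).getD n 0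

noncomputable def Tgt : PowerSeries ℤ :=
  (∑ k ∈ Finset.range 17, C (cP k) * X ^ k) +
  ∑ r ∈ Finset.range 12, (C (cA r) * (X ^ (17 + r) * VV fun _ => 1) +
    C (cB r) * (X ^ (17 + r) * VV fun m => m + 1) +
    C (cC r) * (X ^ (17 + r) * VV fun m => (m + 1) * (m + 2)) +
    C 192 * (X ^ (17 + r) * VV fun m => (m + 1) * (m + 2) * (m + 3)))

theorem Per_Tgt (p : ℕ) : Per p Tgt := by
  refine Per.add (Per.sum _ _ fun k hk => (Per.low p k hk).smul _) (Per.sum _ _ fun r hr => ?_)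
  refine ((Per.add ?_ ?_).add ?_).add ?_ <;> refine Per.smul _ (Per.VV _ (fun m => ?_) r hr)
  · simp
  · exact ⟨1, by push_cast; ring⟩
  · exact ⟨2 * m + p + 3, by push_cast; ring⟩
  · exact ⟨3 * m ^ 2 + 3 * m * p + p ^ 2 + 12 * m + 6 * p + 11, by push_cast; ring⟩

noncomputable def ww : PowerSeries ℤ := 1 - X ^ 12
noncomputable def q1 : PowerSeries ℤ := 1 + X + X ^ 2 + X ^ 3 + X ^ 4 + X ^ 5 + X ^ 6 + X ^ 7 + X ^ 8 + X ^ 9 + X ^ 10 + X ^ 11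
noncomputable def q2 : PowerSeries ℤ := 1 + X ^ 2 + X ^ 4 + X ^ 6 + X ^ 8 + X ^ 10
noncomputable def q3 : PowerSeries ℤ := 1 + X ^ 3 + X ^ 6 + X ^ 9
noncomputable def q4 : PowerSeries ℤ := 1 + X ^ 4 + X ^ 8

theorem hq1 : (1 - X ^ 1) * q1 = ww := by unfold q1 ww; ring
theorem hq2 : (1 - X ^ 2) * q2 = ww := by unfold q2 ww; ring
theorem hq3 : (1 - X ^ 3) * q3 = ww := by unfold q3 ww; ring
theorem hq4 : (1 - X ^ 4) * q4 = ww := by unfold q4 ww; ring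

/-- Clear one denominator. -/
theorem clear {F D q c d e u : PowerSeries ℤ} (hF : F * D = u * c) (hq : D * q = ww) (hc : c * d = e) :
    F * (d * ww) = u * (e * q) := by
  rw [← hq, ← hc]; linear_combination d * q * hF

theorem botsat (M : ℕ) : GF (BotL M 1 M) * ww = q1 ∧ GF (BotL M 2 M) * ww ^ 2 = q1 * q2 ∧
    GF (BotL M 3 M) * ww ^ 3 = q1 * q2 * q3 ∧ GF (BotL M 4 M) * ww ^ 4 = q1 * q2 * q3 * q4 := by
  have s1 := GF_Bot_sat M 0
  have s2 := GF_Bot_sat M 1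
  have s3 := GF_Bot_sat M 2
  have s4 := GF_Bot_sat M 3
  rw [Bot_zero, GF_nil] at s1
  simp only [Nat.reduceAdd] at *
  have t1 : GF (BotL M 1 M) * ww = q1 := by rw [← hq1]; linear_combination q1 * s1
  have t2 : GF (BotL M 2 M) * ww ^ 2 = q1 * q2 := by
    rw [← t1]; nth_rw 1 [pow_two, ← hq2]; linear_combination q2 * ww * s2
  have t3 : GF (BotL M 3 M) * ww ^ 3 = q1 * q2 * q3 := by
    rw [← t2, pow_succ]; nth_rw 2 [← hq3]; linear_combination q3 * ww ^ 2 * s3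
  have t4 : GF (BotL M 4 M) * ww ^ 4 = q1 * q2 * q3 * q4 := by
    rw [← t3, pow_succ]; nth_rw 2 [← hq4]; linear_combination q4 * ww ^ 3 * s4
  exact ⟨t1, t2, t3, t4⟩

theorem K_one : GF (BotL 1 1 0) * ww = X * q1 := by
  have e0 := GF_Bot_two 1 0 0 (by omega)
  obtain ⟨s1, -⟩ := botsat 1
  simp only [Nat.reduceAdd] at *
  rw [e0]; linear_combination X * s1

theorem K_two : GF (BotL 2 2 0) * ww ^ 2 = X ^ 4 * (q1 * q2) + X ^ 3 * ww * q1 := by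
  have e20 := GF_Bot_two 2 1 0 (by omega)
  have e21 := GF_Bot_one 2 1 1 (by omega)
  have e11 := GF_Bot_two 2 0 1 (by omega)
  obtain ⟨s1, s2, -⟩ := botsat 2
  simp only [Nat.reduceAdd] at *
  rw [e20, e21, e11]
  linear_combination X ^ 4 * s2 + X ^ 3 * ww * s1

theorem K_three : GF (BotL 3 3 0) * ww ^ 3 = X ^ 9 * (q1 * q2 * q3) +
    (X ^ 6 + X ^ 5) * (X ^ 2 * ww * (q1 * q2) + X * ww ^ 2 * q1) := by
  have e30 := GF_Bot_two 3 2 0 (by omega)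
  have e31 := GF_Bot_one 3 2 1 (by omega)
  have e32 := GF_Bot_one 3 2 2 (by omega)
  have e21 := GF_Bot_two 3 1 1 (by omega)
  have e22 := GF_Bot_one 3 1 2 (by omega)
  have e12 := GF_Bot_two 3 0 2 (by omega)
  obtain ⟨s1, s2, s3, -⟩ := botsat 3
  simp only [Nat.reduceAdd] at *
  rw [e30, e31, e32, e21, e22, e12]
  linear_combination X ^ 9 * s3 + (X ^ 6 + X ^ 5) * (X ^ 2 * ww * s2 + X * ww ^ 2 * s1)

theorem K_four : GF (BotL 4 4 0) * ww ^ 4 = X ^ 16 * (q1 * q2 * q3 * q4) +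
    (X ^ 15 + (X ^ 8 + X ^ 7) * X ^ 6) * ww * (q1 * q2 * q3) +
    (X ^ 12 + (X ^ 8 + X ^ 7) * (X ^ 3 + X ^ 2)) * (X ^ 2 * ww ^ 2 * (q1 * q2) + X * ww ^ 3 * q1) := by
  have e40 := GF_Bot_two 4 3 0 (by omega)
  have e41 := GF_Bot_one 4 3 1 (by omega)
  have e42 := GF_Bot_one 4 3 2 (by omega)
  have e43 := GF_Bot_one 4 3 3 (by omega)
  have e31 := GF_Bot_two 4 2 1 (by omega)
  have e32 := GF_Bot_one 4 2 2 (by omega)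
  have e33 := GF_Bot_one 4 2 3 (by omega)
  have e22 := GF_Bot_two 4 1 2 (by omega)
  have e23 := GF_Bot_one 4 1 3 (by omega)
  have e13 := GF_Bot_two 4 0 3 (by omega)
  obtain ⟨s1, s2, s3, s4⟩ := botsat 4
  simp only [Nat.reduceAdd] at *
  rw [e40, e41, e42, e43, e31, e32, e33, e22, e23, e13]
  linear_combination X ^ 16 * s4 + (X ^ 15 + (X ^ 8 + X ^ 7) * X ^ 6) * ww * s3 +
    (X ^ 12 + (X ^ 8 + X ^ 7) * (X ^ 3 + X ^ 2)) * (X ^ 2 * ww ^ 2 * s2 + X * ww ^ 3 * s1)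

theorem topsat : GF (TopL [5] 5) * ww = X ^ 5 * q1 ∧ GF (TopL [4, 5] 5) * ww ^ 2 = X ^ 10 * (q1 * q2) ∧
    GF (TopL [3, 4, 5] 5) * ww ^ 3 = X ^ 15 * (q1 * q2 * q3) ∧
    GF (TopL [2, 3, 4, 5] 5) * ww ^ 4 = X ^ 20 * (q1 * q2 * q3 * q4) := by
  have s1 := GF_Top_sat 5 [] 5 (by omega) (by simp)
  have s2 := GF_Top_sat 4 [5] 5 (by omega) (by simp)
  have s3 := GF_Top_sat 3 [4, 5] 5 (by omega) (by simp)
  have s4 := GF_Top_sat 2 [3, 4, 5] 5 (by omega) (by simp)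
  rw [GF_Top_nil 5 (by omega)] at s1
  simp only [List.length_cons, List.length_nil, Nat.reduceAdd] at s1 s2 s3 s4
  have t1 : GF (TopL [5] 5) * ww = X ^ 5 * q1 := by rw [← hq1]; linear_combination q1 * s1
  have t2 : GF (TopL [4, 5] 5) * ww ^ 2 = X ^ 10 * (q1 * q2) := by
    have : GF (TopL [4, 5] 5) * (ww * ww) = X ^ 5 * (X ^ 5 * q1 * q2) := clear s2 hq2 t1
    linear_combination this
  have t3 : GF (TopL [3, 4, 5] 5) * ww ^ 3 = X ^ 15 * (q1 * q2 * q3) := by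
    have : GF (TopL [3, 4, 5] 5) * (ww ^ 2 * ww) = _ := clear s3 hq3 t2
    linear_combination this
  have t4 : GF (TopL [2, 3, 4, 5] 5) * ww ^ 4 = X ^ 20 * (q1 * q2 * q3 * q4) := by
    have : GF (TopL [2, 3, 4, 5] 5) * (ww ^ 3 * ww) = _ := clear s4 hq4 t3
    linear_combination this
  exact ⟨t1, t2, t3, t4⟩

theorem T_one : GF (TopL [5] 1) * ww = X ^ 5 * q1 := by
  rw [Top_low 5 [] 1 (by omega) (by omega)]; exact topsat.1

theorem T_two' : GF (TopL [4, 5] 4) = X ^ 4 * GF (TopL [5] 5) + GF (TopL [4, 5] 5) := by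
  rw [GF_Top_cons 4 [5] 4 (by omega) (by omega), Top_low 5 [] 4 (by omega) (by omega)]

theorem T_three' : GF (TopL [3, 4, 5] 4) = X ^ 4 * GF (TopL [4, 5] 4) + GF (TopL [3, 4, 5] 5) :=
  GF_Top_cons 3 [4, 5] 4 (by omega) (by omega)

theorem T_three'' : GF (TopL [3, 4, 5] 3) = X ^ 3 * GF (TopL [4, 5] 4) + GF (TopL [3, 4, 5] 4) := by
  rw [GF_Top_cons 3 [4, 5] 3 (by omega) (by omega), Top_low 4 [5] 3 (by omega) (by omega)]

theorem T_two : GF (TopL [4, 5] 1) * ww ^ 2 = X ^ 9 * ww * q1 + X ^ 10 * (q1 * q2) := by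
  rw [Top_low 4 [5] 1 (by omega) (by omega), T_two']
  obtain ⟨s1, s2, -⟩ := topsat
  linear_combination X ^ 4 * ww * s1 + s2

theorem T_three : GF (TopL [3, 4, 5] 1) * ww ^ 3 =
    (X ^ 3 + X ^ 4) * ww * (X ^ 9 * ww * q1 + X ^ 10 * (q1 * q2)) + X ^ 15 * (q1 * q2 * q3) := by
  rw [Top_low 3 [4, 5] 1 (by omega) (by omega), T_three'', T_three', T_two']
  obtain ⟨s1, s2, s3, -⟩ := topsat
  linear_combination (X ^ 3 + X ^ 4) * ww * (X ^ 4 * ww * s1 + s2) + s3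

theorem T_four : GF (TopL [2, 3, 4, 5] 1) * ww ^ 4 =
    ((X ^ 2 + X ^ 3) * (X ^ 3 + X ^ 4) + X ^ 8) * ww ^ 2 * (X ^ 9 * ww * q1 + X ^ 10 * (q1 * q2))
     + (X ^ 2 + X ^ 3 + X ^ 4) * ww * (X ^ 15 * (q1 * q2 * q3)) + X ^ 20 * (q1 * q2 * q3 * q4) := by
  rw [Top_low 2 [3, 4, 5] 1 (by omega) (by omega), GF_Top_cons 2 [3, 4, 5] 2 (by omega) (by omega),
    GF_Top_cons 2 [3, 4, 5] 3 (by omega) (by omega), GF_Top_cons 2 [3, 4, 5] 4 (by omega) (by omega),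
    Top_low 3 [4, 5] 2 (by omega) (by omega), T_three'', T_three', T_two']
  obtain ⟨s1, s2, s3, s4⟩ := topsat
  linear_combination ((X ^ 2 + X ^ 3) * (X ^ 3 + X ^ 4) + X ^ 8) * ww ^ 2 * (X ^ 4 * ww * s1 + s2)
    + (X ^ 2 + X ^ 3 + X ^ 4) * ww * s3 + s4

theorem Tgt_mul : Tgt * ww ^ 4 = (∑ k ∈ Finset.range 17, C (cP k) * X ^ k) * ww ^ 4 +
    X ^ 17 * ∑ r ∈ Finset.range 12, X ^ r * (C (cA r) * ww ^ 3 + C (cB r) * ww ^ 2 + 2 * C (cC r) * ww + 6 * 192) := by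
  have v1 : (VV fun _ => 1) * ww = 1 := VV_one
  have v2 : (VV fun m => (m : ℤ) + 1) * ww = VV fun _ => 1 := VV_mul _ _ (by simp) (by simp)
  have v3 : (VV fun m => ((m : ℤ) + 1) * (m + 2)) * ww ^ 3 = 2 := by
    have : (VV fun m => ((m : ℤ) + 1) * (m + 2)) * ww = VV fun m => 2 * ((m : ℤ) + 1) :=
      VV_mul _ _ (by simp) (by intro m; push_cast; ring)
    have h2 : (VV fun m => 2 * ((m : ℤ) + 1)) * ww = VV fun _ => 2 :=
      VV_mul _ _ (by simp) (by intro m; push_cast; ring)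
    have h3 : (VV fun _ => 2) = 2 * (VV fun _ => 1) := by
      rw [two_mul]; ext n; simp only [VV, map_add, coeff_mk]; split_ifs <;> rfl
    linear_combination ww ^ 2 * this + ww * h2 + ww * h3 + 2 * v1
  have v4 : (VV fun m => ((m : ℤ) + 1) * (m + 2) * (m + 3)) * ww ^ 4 = 6 := by
    have : (VV fun m => ((m : ℤ) + 1) * (m + 2) * (m + 3)) * ww = VV fun m => 3 * (((m : ℤ) + 1) * (m + 2)) :=
      VV_mul _ _ (by simp) (by intro m; push_cast; ring)
    have h3 : (VV fun m => 3 * (((m : ℤ) + 1) * (m + 2))) = 3 * (VV fun m => (((m : ℤ) + 1) * (m + 2))) := by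
      rw [show (3 : PowerSeries ℤ) = C 3 by simp]
      ext n; simp only [VV, coeff_C_mul, coeff_mk]; split_ifs <;> simp
    linear_combination ww ^ 3 * this + ww ^ 3 * h3 + 3 * v3
  rw [Tgt, add_mul]
  congr 1
  rw [Finset.sum_mul, Finset.mul_sum]
  refine Finset.sum_congr rfl fun r _ => ?_
  rw [show (C 192 : PowerSeries ℤ) = 192 by simp, pow_add]
  linear_combination X ^ 17 * X ^ r * (C (cA r) * ww ^ 3 * v1 + C (cB r) * (ww ^ 3 * v2 + ww ^ 2 * v1) +
    C (cC r) * ww * v3 + 192 * v4)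

set_option maxHeartbeats 4000000 in
theorem main_id : GF DL * ww ^ 4 = Tgt * ww ^ 4 := by
  have h : GF DL * ww ^ 4 = GF (BotL 4 4 0) * ww ^ 4 + (GF (TopL [5] 1) * ww) * (GF (BotL 3 3 0) * ww ^ 3)
      + (GF (TopL [4, 5] 1) * ww ^ 2) * (GF (BotL 2 2 0) * ww ^ 2)
      + (GF (TopL [3, 4, 5] 1) * ww ^ 3) * (GF (BotL 1 1 0) * ww) + GF (TopL [2, 3, 4, 5] 1) * ww ^ 4 := by
    rw [GF_DL', GF_Top_nil 1 le_rfl, Bot_zero, GF_nil]; ring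
  rw [h, Tgt_mul, K_four, K_three, K_two, K_one, T_one, T_two, T_three, T_four]
  simp only [Finset.sum_range_succ, Finset.sum_range_zero, cP, cA, cB, cC, List.getD_cons_zero,
    List.getD_cons_succ, map_neg, map_ofNat, map_zero, map_one]
  unfold q1 q2 q3 q4 ww
  ring

theorem GF_DL_eq : GF DL = Tgt := by
  have v1 : (VV fun _ => 1) * ww = 1 := VV_one
  calc GF DL = GF DL * ww ^ 4 * (VV fun _ => 1) ^ 4 := by
        rw [mul_assoc, ← mul_pow, mul_comm ww, v1]; simp
    _ = Tgt * ww ^ 4 * (VV fun _ => 1) ^ 4 := by rw [main_id]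
    _ = Tgt := by rw [mul_assoc, ← mul_pow, mul_comm ww, v1]; simp

end

theorem R_four_periodic (p n : ℕ) (hp : 2 ≤ p) (hn : 16 < n) :
    R 4 (n + 12 * p) ≡ R 4 n [MOD p] := by
  have h := Per_Tgt p n hn
  rw [← GF_DL_eq] at h
  simp only [GF, PowerSeries.coeff_mk] at h
  rw [R_eq, R_eq]
  exact ((Nat.modEq_iff_dvd).2 h).symm
end
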